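/- arXiv:2208.11255 — 15 statements merged into one kernel-verified Lean document; each statement's English description precedes it below -/
import Mathlib

section
/- For all real numbers t > 0 and x ∈ ℝ: ∫₀ᵗ ∫_ℝ ρ(t−r, x−z)² · ρ(r, z)² dz dr = (√(πt)/2) · ρ(t, x)². -/
open MeasureTheory

/-- The one-dimensional heat kernel `ρ(t,x) = (2πt)^{-1/2} exp(-x²/(2t))` for `t > 0`,
extended by `0` for `t ≤ 0`. -/
noncomputable def heatKer (t x : ℝ) : ℝ :=
  if 0 < t then Real.exp (-x ^ 2 / (2 * t)) / Real.sqrt (2 * Real.pi * t) else 0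

lemma inner_int (t x r : ℝ) (hr : 0 < r) (hrt : r < t) :
    ∫ z : ℝ, heatKer (t - r) (x - z) ^ 2 * heatKer r z ^ 2 =
      Real.exp (-x ^ 2 / t) * Real.sqrt (Real.pi / t) / (4 * Real.pi ^ 2) *
        (1 / Real.sqrt (r * (t - r))) := by
  have hs : 0 < t - r := by linarith
  have ht : 0 < t := by linarith
  have hpi := Real.pi_pos
  have h1 : ∀ z : ℝ, heatKer (t - r) (x - z) ^ 2 * heatKer r z ^ 2 =
      Real.exp (-x ^ 2 / t) / (4 * Real.pi ^ 2 * (r * (t - r))) *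
        Real.exp (-(t / (r * (t - r))) * (z - x * r / t) ^ 2) := by
    intro z
    have e : Real.exp (-(x - z) ^ 2 / (2 * (t - r))) ^ 2 * Real.exp (-z ^ 2 / (2 * r)) ^ 2
        = Real.exp (-x ^ 2 / t) * Real.exp (-(t / (r * (t - r))) * (z - x * r / t) ^ 2) := by
      rw [← Real.exp_nat_mul, ← Real.exp_nat_mul, ← Real.exp_add, ← Real.exp_add]
      congr 1
      have := hs.ne'
      push_cast
      field_simp
      ring
    simp only [heatKer, hs, hr, if_true, div_pow]
    rw [Real.sq_sqrt (by positivity), Real.sq_sqrt (by positivity), div_mul_div_comm, e]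
    have := hs.ne'
    field_simp
    ring
  simp_rw [h1]
  rw [integral_const_mul,
    integral_sub_right_eq_self (fun z => Real.exp (-(t / (r * (t - r))) * z ^ 2)) (x * r / t),
    integral_gaussian]
  have hp : 0 < r * (t - r) := by positivity
  generalize r * (t - r) = p at hp
  have h2 : Real.pi / (t / p) = Real.pi / t * p := by field_simp
  rw [h2, Real.sqrt_mul (by positivity)]
  have h3 := Real.sq_sqrt hp.le
  have h4 := Real.sqrt_pos.2 hp
  generalize Real.sqrt p = q at h3 h4
  subst h3
  field_simp

lemma outer_int (t : ℝ) (ht : 0 < t) :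
    ∫ r in (0:ℝ)..t, 1 / Real.sqrt (r * (t - r)) = Real.pi := by
  have hd : ∀ r ∈ Set.Ioo 0 t, HasDerivAt (fun r => Real.arcsin (2 * r / t - 1))
      (1 / Real.sqrt (r * (t - r))) r := by
    intro r hr
    obtain ⟨h0, h1⟩ := hr
    have hs : 0 < t - r := by linarith
    have a1 : 2 * r / t - 1 ≠ -1 := by
      have : 0 < 2 * r / t := by positivity
      linarith
    have a2 : 2 * r / t - 1 ≠ 1 := by
      have : 2 * r / t < 2 := by rw [div_lt_iff₀ ht]; linarith
      linarith
    have h := (Real.hasDerivAt_arcsin a1 a2).comp r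
      ((((hasDerivAt_id r).const_mul 2).div_const t).sub_const 1)
    suffices key : 1 / Real.sqrt (r * (t - r)) =
        1 / Real.sqrt (1 - (2 * r / t - 1) ^ 2) * (2 * 1 / t) by
      rw [key]; exact h
    have : 1 - (2 * r / t - 1) ^ 2 = (2 / t) ^ 2 * (r * (t - r)) := by
      field_simp
      ring
    rw [this, Real.sqrt_mul (sq_nonneg (2 / t)), Real.sqrt_sq (by positivity)]
    have : 0 < Real.sqrt (r * (t - r)) := by positivity
    field_simp
  have hc : ContinuousOn (fun r => Real.arcsin (2 * r / t - 1)) (Set.Icc 0 t) := by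
    apply Continuous.continuousOn
    exact Real.continuous_arcsin.comp (by fun_prop)
  have hi := intervalIntegral.integrableOn_deriv_of_nonneg hc hd
    (fun r _ => by positivity)
  rw [intervalIntegral.integral_eq_sub_of_hasDerivAt_of_le ht.le hc hd
    ((intervalIntegrable_iff_integrableOn_Ioc_of_le ht.le).2 hi)]
  have : 2 * t / t - 1 = 1 := by field_simp; norm_num
  simp [this]

/-- Lemma C.2 (lem:int1): for `t > 0` and `x ∈ ℝ`,
`∫₀ᵗ ∫_ℝ ρ(t−r, x−z)² ρ(r, z)² dz dr = (√(πt)/2) ρ(t, x)²`. -/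
theorem stmt1 (t x : ℝ) (ht : 0 < t) :
    ∫ r in (0:ℝ)..t, ∫ z : ℝ, heatKer (t - r) (x - z) ^ 2 * heatKer r z ^ 2 =
      Real.sqrt (Real.pi * t) / 2 * heatKer t x ^ 2 := by
  have hpi := Real.pi_pos
  have h : ∫ r in (0:ℝ)..t, ∫ z : ℝ, heatKer (t - r) (x - z) ^ 2 * heatKer r z ^ 2 =
      ∫ r in (0:ℝ)..t, Real.exp (-x ^ 2 / t) * Real.sqrt (Real.pi / t) / (4 * Real.pi ^ 2) *
        (1 / Real.sqrt (r * (t - r))) := by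
    rw [intervalIntegral.integral_of_le ht.le, intervalIntegral.integral_of_le ht.le,
      integral_Ioc_eq_integral_Ioo, integral_Ioc_eq_integral_Ioo]
    exact setIntegral_congr_fun measurableSet_Ioo (fun r hr => inner_int t x r hr.1 hr.2)
  rw [h, intervalIntegral.integral_const_mul, outer_int t ht]
  simp only [heatKer, ht, if_true, div_pow]
  rw [Real.sq_sqrt (by positivity), ← Real.exp_nat_mul]
  have e : ((2:ℕ):ℝ) * (-x ^ 2 / (2 * t)) = -x ^ 2 / t := by
    push_cast
    field_simp
  have e2 : Real.sqrt (Real.pi * t) = t * Real.sqrt (Real.pi / t) := by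
    have : Real.pi * t = t ^ 2 * (Real.pi / t) := by field_simp
    rw [this, Real.sqrt_mul (by positivity), Real.sqrt_sq ht.le]
  rw [e, e2]
  field_simp
  try norm_num
end

section
/- For all real numbers t > 0, h > 0 and x ∈ ℝ: ∫₀ᵗ ∫_ℝ ρ(t+h−r, x−z)² · ρ(r, z)² dz dr = (√(t+h)/(2√π)) · ( arcsin(1 − 2h/(t+h)) + π/2 ) · ρ(t+h, x)². -/
open MeasureTheory

lemma heat_inner (s r x : ℝ) (hr : 0 < r) (hrs : r < s) :
    ∫ z : ℝ, heatKer (s - r) (x - z) ^ 2 * heatKer r z ^ 2 =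
      (Real.sqrt s / (2 * Real.sqrt Real.pi) * heatKer s x ^ 2) *
        (1 / Real.sqrt (1 - ((2 * r - s) / s) ^ 2) * (2 / s)) := by
  have hs : 0 < s := hr.trans hrs
  have ha : 0 < s - r := sub_pos.mpr hrs
  have hpi := Real.pi_pos
  have key : ∀ z : ℝ, heatKer (s - r) (x - z) ^ 2 * heatKer r z ^ 2 =
      (heatKer s x ^ 2 * (2 * Real.pi * s) / (4 * Real.pi ^ 2 * ((s - r) * r))) *
        Real.exp (-(s / ((s - r) * r)) * (z - r * x / s) ^ 2) := by
    intro z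
    unfold heatKer
    rw [if_pos hs, if_pos hr, if_pos ha]
    simp only [div_pow]
    rw [Real.sq_sqrt (by positivity), Real.sq_sqrt (by positivity), Real.sq_sqrt (by positivity)]
    simp only [← Real.exp_nat_mul]
    have e : Real.exp (((2 : ℕ) : ℝ) * (-(x - z) ^ 2 / (2 * (s - r)))) *
        Real.exp (((2 : ℕ) : ℝ) * (-z ^ 2 / (2 * r))) =
        Real.exp (((2 : ℕ) : ℝ) * (-x ^ 2 / (2 * s))) *
        Real.exp (-(s / ((s - r) * r)) * (z - r * x / s) ^ 2) := by
      rw [← Real.exp_add, ← Real.exp_add]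
      congr 1
      push_cast
      field_simp
      ring
    rw [div_mul_div_comm, e]
    field_simp
    ring
  simp_rw [key]
  rw [integral_const_mul]
  rw [integral_sub_right_eq_self (fun z : ℝ => Real.exp (-(s / ((s - r) * r)) * z ^ 2)) (r * x / s),
    integral_gaussian]
  have h1 : 1 - ((2 * r - s) / s) ^ 2 = (2 / s) ^ 2 * ((s - r) * r) := by
    field_simp
    ring
  have h2 : Real.pi / (s / ((s - r) * r)) = Real.pi * ((s - r) * r) / s := by
    field_simp
  have hq : 0 < (s - r) * r := by positivity
  rw [h1, h2, Real.sqrt_mul (by positivity), Real.sqrt_sq (by positivity),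
    Real.sqrt_div (by positivity), Real.sqrt_mul hpi.le]
  generalize heatKer s x ^ 2 = k
  generalize (s - r) * r = q at *
  obtain ⟨u, hu, rfl⟩ : ∃ u, 0 < u ∧ q = u ^ 2 :=
    ⟨Real.sqrt q, by positivity, (Real.sq_sqrt hq.le).symm⟩
  have hu2 := Real.sqrt_sq hu.le
  have hs2 := Real.sq_sqrt hs.le
  have hp2 := Real.sq_sqrt hpi.le
  have hsp : 0 < Real.sqrt s := by positivity
  have hpp : 0 < Real.sqrt Real.pi := by positivity
  rw [hu2]
  generalize Real.sqrt s = S at *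
  generalize Real.sqrt Real.pi = P at *
  rw [← hs2, ← hp2]
  field_simp
  try ring

/-- Lemma C.3 (lem:int3): for `t > 0`, `h > 0` and `x ∈ ℝ`,
`∫₀ᵗ ∫_ℝ ρ(t+h−r, x−z)² ρ(r, z)² dz dr
  = (√(t+h)/(2√π)) (arcsin(1 − 2h/(t+h)) + π/2) ρ(t+h, x)²`. -/
theorem stmt2 (t h x : ℝ) (ht : 0 < t) (hh : 0 < h) :
    ∫ r in (0:ℝ)..t, ∫ z : ℝ, heatKer (t + h - r) (x - z) ^ 2 * heatKer r z ^ 2 =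
      Real.sqrt (t + h) / (2 * Real.sqrt Real.pi) *
        (Real.arcsin (1 - 2 * h / (t + h)) + Real.pi / 2) * heatKer (t + h) x ^ 2 := by
  have hs : 0 < t + h := by positivity
  set s := t + h with hsdef
  have hts : t < s := by linarith
  have hd : ∀ r ∈ Set.Ioo 0 t, HasDerivAt (fun r => Real.arcsin ((2 * r - s) / s))
      (1 / Real.sqrt (1 - ((2 * r - s) / s) ^ 2) * (2 / s)) r := by
    intro r hr
    have h1 : (2 * r - s) / s ≠ -1 := by
      intro hc
      rw [div_eq_iff hs.ne'] at hc
      linarith [hr.1]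
    have h2 : (2 * r - s) / s ≠ 1 := by
      intro hc
      rw [div_eq_iff hs.ne'] at hc
      linarith [hr.2]
    have hl : HasDerivAt (fun r : ℝ => (2 * r - s) / s) (2 / s) r := by
      simpa using (((hasDerivAt_id r).const_mul 2).sub_const s).div_const s
    exact (Real.hasDerivAt_arcsin h1 h2).comp r hl
  have hcont : ContinuousOn (fun r => Real.arcsin ((2 * r - s) / s)) (Set.Icc 0 t) :=
    (Real.continuous_arcsin.comp (by fun_prop)).continuousOn
  have hint : IntervalIntegrable
      (fun r => 1 / Real.sqrt (1 - ((2 * r - s) / s) ^ 2) * (2 / s)) volume 0 t := by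
    rw [intervalIntegrable_iff_integrableOn_Ioc_of_le ht.le]
    exact intervalIntegral.integrableOn_deriv_of_nonneg hcont hd (fun r _ => by positivity)
  have hF := intervalIntegral.integral_eq_sub_of_hasDerivAt_of_le ht.le hcont hd hint
  have hcongr : ∫ r in (0:ℝ)..t, ∫ z : ℝ, heatKer (s - r) (x - z) ^ 2 * heatKer r z ^ 2 =
      ∫ r in (0:ℝ)..t, (Real.sqrt s / (2 * Real.sqrt Real.pi) * heatKer s x ^ 2) *
        (1 / Real.sqrt (1 - ((2 * r - s) / s) ^ 2) * (2 / s)) := by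
    apply intervalIntegral.integral_congr_ae
    refine Filter.Eventually.of_forall fun r hr => ?_
    rw [Set.uIoc_of_le ht.le] at hr
    exact heat_inner s r x hr.1 (lt_of_le_of_lt hr.2 hts)
  rw [hcongr, intervalIntegral.integral_const_mul, hF]
  have e1 : (2 * t - s) / s = 1 - 2 * h / s := by
    rw [hsdef]
    field_simp
    ring
  have e2 : (2 * 0 - s) / s = -1 := by
    field_simp
    ring
  rw [e1, e2, Real.arcsin_neg_one]
  ring
end

section
/- For all real numbers t > 0, h > 0 and x ∈ ℝ: ∫_t^{t+h} ∫_ℝ ρ(t+h−r, x−z)² · ρ(r, z)² dz dr = (√(t+h)/(2√π)) · ( π/2 − arcsin(1 − 2h/(t+h)) ) · ρ(t+h, x)², and moreover this quantity is at most 4·√h · ρ(t+h, x)². -/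
open MeasureTheory

theorem heatKer_sq {t : ℝ} (ht : 0 < t) (x : ℝ) :
    heatKer t x ^ 2 = Real.exp (-x ^ 2 / t) / (2 * Real.pi * t) := by
  have hpi := Real.pi_pos
  unfold heatKer
  rw [if_pos ht, div_pow, Real.sq_sqrt (by positivity), ← Real.exp_nat_mul]
  congr 2
  push_cast
  field_simp

theorem inner_eq {a b : ℝ} (ha : 0 < a) (hb : 0 < b) (x : ℝ) :
    (∫ z : ℝ, heatKer a (x - z) ^ 2 * heatKer b z ^ 2) =
      Real.sqrt (a + b) / (2 * Real.sqrt Real.pi) * heatKer (a + b) x ^ 2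
        * (1 / Real.sqrt (a * b)) := by
  have hpi := Real.pi_pos
  have hab : 0 < a + b := by positivity
  have h1 : ∀ z : ℝ, heatKer a (x - z) ^ 2 * heatKer b z ^ 2 =
      (Real.exp (-x ^ 2 / (a + b)) / (4 * Real.pi ^ 2 * (a * b))) *
        Real.exp (-((a + b) / (a * b)) * (z - b * x / (a + b)) ^ 2) := by
    intro z
    rw [heatKer_sq ha, heatKer_sq hb, div_mul_div_comm, ← Real.exp_add, div_mul_eq_mul_div,
      ← Real.exp_add]
    congr 1
    · congr 1
      field_simp
      ring
    · ring
  simp_rw [h1]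
  rw [integral_const_mul,
    integral_sub_right_eq_self (fun z : ℝ => Real.exp (-((a + b) / (a * b)) * z ^ 2)),
    integral_gaussian, heatKer_sq hab]
  have h2 : Real.sqrt (Real.pi / ((a + b) / (a * b))) =
      Real.sqrt Real.pi * Real.sqrt (a * b) / Real.sqrt (a + b) := by
    rw [← Real.sqrt_mul hpi.le, ← Real.sqrt_div (by positivity)]
    congr 1
    field_simp
  rw [h2]
  have e1 := Real.sq_sqrt hpi.le
  have e2 := Real.sq_sqrt (show 0 ≤ a * b by positivity)
  have e3 := Real.sq_sqrt hab.le
  have p1 := Real.sqrt_pos.2 hpi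
  have p2 := Real.sqrt_pos.2 (show 0 < a * b by positivity)
  have p3 := Real.sqrt_pos.2 hab
  generalize Real.exp (-x ^ 2 / (a + b)) = E
  generalize Real.sqrt Real.pi = s at *
  generalize Real.sqrt (a * b) = u at *
  generalize Real.sqrt (a + b) = v at *
  rw [← e1, ← e2, ← e3]
  field_simp
  try ring

theorem outer_eq {t h : ℝ} (ht : 0 < t) (hh : 0 < h) :
    (∫ r in t..(t + h), 1 / Real.sqrt ((t + h - r) * r)) =
      Real.pi / 2 - Real.arcsin (1 - 2 * h / (t + h)) := by
  have hT : 0 < t + h := by positivity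
  have hle : t ≤ t + h := by linarith
  have hc : Continuous (fun r : ℝ => Real.arcsin (2 * r / (t + h) - 1)) :=
    Real.continuous_arcsin.comp (by fun_prop)
  have hd : ∀ r ∈ Set.Ioo t (t + h), HasDerivAt (fun r : ℝ => Real.arcsin (2 * r / (t + h) - 1))
      (1 / Real.sqrt ((t + h - r) * r)) r := by
    intro r ⟨hr1, hr2⟩
    have hr : 0 < r := by linarith
    have hr3 : 0 < t + h - r := by linarith
    have n1 : 2 * r / (t + h) - 1 ≠ -1 := by
      have : 0 < 2 * r / (t + h) := by positivity
      linarith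
    have n2 : 2 * r / (t + h) - 1 ≠ 1 := by
      have : 2 * r / (t + h) < 2 := by
        rw [div_lt_iff₀ hT]
        linarith
      linarith
    have hl : HasDerivAt (fun r : ℝ => 2 * r / (t + h) - 1) (2 / (t + h)) r := by
      have := (((hasDerivAt_id r).const_mul 2).div_const (t + h)).sub_const 1
      simpa using this
    have hcomp := (Real.hasDerivAt_arcsin n1 n2).comp r hl
    refine HasDerivAt.congr_deriv (f := fun r : ℝ => Real.arcsin (2 * r / (t + h) - 1)) hcomp ?_
    have : 1 - (2 * r / (t + h) - 1) ^ 2 = ((t + h - r) * r) * (2 / (t + h)) ^ 2 := by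
      field_simp
      ring
    rw [this, Real.sqrt_mul (by positivity), Real.sqrt_sq (by positivity)]
    have := Real.sqrt_pos.2 (show 0 < (t + h - r) * r by positivity)
    field_simp
  rw [intervalIntegral.integral_eq_sub_of_hasDerivAt_of_le hle hc.continuousOn hd]
  · have e1 : 2 * (t + h) / (t + h) - 1 = 1 := by
      field_simp
      ring
    have e2 : 2 * t / (t + h) - 1 = 1 - 2 * h / (t + h) := by
      field_simp
      ring
    rw [e1, e2, Real.arcsin_one]
  · apply intervalIntegral.intervalIntegrable_deriv_of_nonneg hc.continuousOn
    · rw [min_eq_left hle, max_eq_right hle]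
      exact hd
    · intro r _
      positivity

theorem angle_le {u : ℝ} (h0 : 0 ≤ u) (h1 : u ≤ 1) :
    Real.pi / 2 - Real.arcsin (1 - 2 * u) ≤ Real.pi * Real.sqrt u := by
  have hpi := Real.pi_pos
  rw [← Real.arccos_eq_pi_div_two_sub_arcsin]
  have n := Real.arccos_nonneg (1 - 2 * u)
  have hc := Real.cos_le_one_sub_mul_cos_sq
    (show |Real.arccos (1 - 2 * u)| ≤ Real.pi by rw [abs_of_nonneg n]; exact Real.arccos_le_pi _)
  rw [Real.cos_arccos (by linarith) (by linarith)] at hc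
  refine (sq_le_sq₀ n (by positivity)).1 ?_
  rw [mul_pow, Real.sq_sqrt h0]
  have : 2 / Real.pi ^ 2 * Real.arccos (1 - 2 * u) ^ 2 ≤ 2 * u := by linarith
  rw [div_mul_eq_mul_div, div_le_iff₀ (by positivity)] at this
  linarith

/-- Lemma C.4 (lem:int4bd): for `t > 0`, `h > 0` and `x ∈ ℝ`,
`∫_t^{t+h} ∫_ℝ ρ(t+h−r, x−z)² ρ(r, z)² dz dr
  = (√(t+h)/(2√π)) (π/2 − arcsin(1 − 2h/(t+h))) ρ(t+h, x)²`,
and this quantity is at most `4 √h ρ(t+h, x)²`. -/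
theorem stmt3 (t h x : ℝ) (ht : 0 < t) (hh : 0 < h) :
    (∫ r in t..(t + h), ∫ z : ℝ, heatKer (t + h - r) (x - z) ^ 2 * heatKer r z ^ 2) =
      Real.sqrt (t + h) / (2 * Real.sqrt Real.pi) *
        (Real.pi / 2 - Real.arcsin (1 - 2 * h / (t + h))) * heatKer (t + h) x ^ 2 ∧
    (∫ r in t..(t + h), ∫ z : ℝ, heatKer (t + h - r) (x - z) ^ 2 * heatKer r z ^ 2) ≤
      4 * Real.sqrt h * heatKer (t + h) x ^ 2 := by
  have hpi := Real.pi_pos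
  have hT : 0 < t + h := by positivity
  have key : (∫ r in t..(t + h), ∫ z : ℝ, heatKer (t + h - r) (x - z) ^ 2 * heatKer r z ^ 2) =
      Real.sqrt (t + h) / (2 * Real.sqrt Real.pi) *
        (Real.pi / 2 - Real.arcsin (1 - 2 * h / (t + h))) * heatKer (t + h) x ^ 2 := by
    have : (∫ r in t..(t + h), ∫ z : ℝ, heatKer (t + h - r) (x - z) ^ 2 * heatKer r z ^ 2) =
        ∫ r in t..(t + h), Real.sqrt (t + h) / (2 * Real.sqrt Real.pi) * heatKer (t + h) x ^ 2
          * (1 / Real.sqrt ((t + h - r) * r)) := by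
      apply intervalIntegral.integral_congr_Ioo_of_le (by linarith)
      intro r hr
      have := inner_eq (a := t + h - r) (b := r) (by linarith [hr.2]) (by linarith [hr.1]) x
      rw [sub_add_cancel] at this
      exact this
    rw [this, intervalIntegral.integral_const_mul, outer_eq ht hh]
    ring
  refine ⟨key, ?_⟩
  rw [key]
  apply mul_le_mul_of_nonneg_right _ (sq_nonneg _)
  have hu1 : h / (t + h) ≤ 1 := by
    rw [div_le_one hT]
    linarith
  have ha := angle_le (u := h / (t + h)) (by positivity) hu1
  rw [← mul_div_assoc, Real.sqrt_div hh.le] at ha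
  have p1 := Real.sqrt_pos.2 hpi
  have p3 := Real.sqrt_pos.2 hT
  have hs : Real.sqrt Real.pi ≤ 8 := by
    rw [Real.sqrt_le_left (by norm_num)]
    linarith [Real.pi_le_four]
  calc _ ≤ Real.sqrt (t + h) / (2 * Real.sqrt Real.pi) *
        (Real.pi * (Real.sqrt h / Real.sqrt (t + h))) :=
        mul_le_mul_of_nonneg_left ha (by positivity)
    _ = Real.sqrt Real.pi / 2 * Real.sqrt h := by
        nth_rewrite 2 [← Real.sq_sqrt hpi.le]
        field_simp
    _ ≤ 4 * Real.sqrt h := by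
        apply mul_le_mul_of_nonneg_right _ (Real.sqrt_nonneg _)
        linarith
end

section
/- For all real numbers t > 0 and x, y ∈ ℝ: ( √(πt)/2 − |x−y|/2 ) · ρ(t,x) · ρ(t,y) ≤ ∫₀ᵗ ∫_ℝ ρ(t−r, y−z) · ρ(t−r, x−z) · ρ(r, z)² dz dr ≤ ( √(πt)/2 ) · ρ(t,x) · ρ(t,y). -/
open MeasureTheory

lemma aux_arctan (u : ℝ) (hu : 0 < u) : u * (Real.pi / 2 - Real.arctan u) ≤ 1 := by
  have h := Real.arctan_inv_of_pos hu
  have h2 : Real.arctan u⁻¹ ≤ u⁻¹ := by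
    have h3 := Real.le_tan (x := Real.arctan u⁻¹)
      (Real.arctan_nonneg.2 (by positivity)) (Real.arctan_lt_pi_div_two _)
    rwa [Real.tan_arctan] at h3
  rw [← h]
  calc u * Real.arctan u⁻¹ ≤ u * u⁻¹ := by gcongr
    _ = 1 := by field_simp

lemma aux_int (b : ℝ) (hb : 0 ≤ b) :
    IntegrableOn (fun u : ℝ => Real.exp (-b * u ^ 2) * (1 + u ^ 2)⁻¹) (Set.Ioi 0) := by
  refine Integrable.mono' (integrable_inv_one_add_sq.integrableOn (s := Set.Ioi 0)) ?_ ?_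
  · exact (Continuous.mul (by fun_prop) (Continuous.inv₀ (by fun_prop)
      (fun x => by positivity))).aestronglyMeasurable
  · refine Filter.Eventually.of_forall fun u => ?_
    rw [Real.norm_of_nonneg (by positivity)]
    have : Real.exp (-b * u ^ 2) ≤ 1 := by
      rw [Real.exp_le_one_iff]; nlinarith [mul_nonneg hb (sq_nonneg u)]
    have h2 : 0 ≤ (1 + u ^ 2)⁻¹ := by positivity
    nlinarith

lemma aux_upper (b : ℝ) (hb : 0 ≤ b) :
    ∫ u in Set.Ioi (0:ℝ), Real.exp (-b * u ^ 2) * (1 + u ^ 2)⁻¹ ≤ Real.pi / 2 := by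
  have h : ∫ u in Set.Ioi (0:ℝ), (1 + u ^ 2)⁻¹ = Real.pi / 2 := by
    simp [integral_Ioi_inv_one_add_sq]
  rw [← h]
  refine integral_mono (aux_int b hb) (integrable_inv_one_add_sq.integrableOn) fun u => ?_
  have : Real.exp (-b * u ^ 2) ≤ 1 := by
    rw [Real.exp_le_one_iff]; nlinarith [mul_nonneg hb (sq_nonneg u)]
  have h2 : 0 ≤ (1 + u ^ 2)⁻¹ := by positivity
  show Real.exp (-b * u ^ 2) * (1 + u ^ 2)⁻¹ ≤ (1 + u ^ 2)⁻¹
  nlinarith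

lemma aux_lower (b : ℝ) (hb : 0 ≤ b) :
    Real.pi / 2 - Real.sqrt (Real.pi * b) ≤
      ∫ u in Set.Ioi (0:ℝ), Real.exp (-b * u ^ 2) * (1 + u ^ 2)⁻¹ := by
  have h : ∫ u in Set.Ioi (0:ℝ), (1 + u ^ 2)⁻¹ = Real.pi / 2 := by
    simp [integral_Ioi_inv_one_add_sq]
  rcases hb.eq_or_lt with rfl | hb'
  · simp
  have hg : IntegrableOn (fun u : ℝ => 2 * b * Real.exp (-b * u ^ 2)) (Set.Ioi 0) :=
    ((integrable_exp_neg_mul_sq hb').const_mul (2 * b)).integrableOn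
  have hI := aux_int b hb
  have hJ : IntegrableOn (fun u : ℝ => (1 + u ^ 2)⁻¹) (Set.Ioi 0) :=
    integrable_inv_one_add_sq.integrableOn
  have hK : IntegrableOn (fun u : ℝ => (u * (Real.pi / 2 - Real.arctan u)) *
      (2 * b * Real.exp (-b * u ^ 2))) (Set.Ioi 0) := by
    refine Integrable.mono' hg ?_ ?_
    · exact Continuous.aestronglyMeasurable (by
        have := Real.continuous_arctan
        fun_prop)
    · refine (ae_restrict_mem measurableSet_Ioi).mono fun u hu => ?_
      have hu' : 0 < u := hu
      have h1 := aux_arctan u hu'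
      have h0 : 0 ≤ Real.pi / 2 - Real.arctan u := by
        linarith [Real.arctan_lt_pi_div_two u]
      rw [Real.norm_of_nonneg (by positivity)]
      exact mul_le_of_le_one_left (by positivity) h1
  have hder : ∀ u ∈ Set.Ici (0:ℝ), HasDerivAt
      (fun u : ℝ => (Real.pi / 2 - Real.arctan u) * (1 - Real.exp (-b * u ^ 2)))
      ((u * (Real.pi / 2 - Real.arctan u)) * (2 * b * Real.exp (-b * u ^ 2))
        - ((1 + u ^ 2)⁻¹ - Real.exp (-b * u ^ 2) * (1 + u ^ 2)⁻¹)) u := by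
    intro u _
    have hp : HasDerivAt (fun v : ℝ => v ^ 2) (2 * u) u := by simpa using hasDerivAt_pow 2 u
    have h1 := (Real.hasDerivAt_arctan u).const_sub (Real.pi / 2)
    have h2 := ((hp.const_mul (-b)).exp).const_sub 1
    have h3 := h1.mul h2
    refine h3.congr_deriv ?_
    simp only [one_div]
    ring
  have hlim : Filter.Tendsto
      (fun u : ℝ => (Real.pi / 2 - Real.arctan u) * (1 - Real.exp (-b * u ^ 2)))
      Filter.atTop (nhds 0) := by
    have h1 : Filter.Tendsto (fun u : ℝ => Real.pi / 2 - Real.arctan u) Filter.atTop (nhds 0) := by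
      have := (Real.tendsto_arctan_atTop.mono_right nhdsWithin_le_nhds).const_sub (Real.pi / 2)
      simpa using this
    refine squeeze_zero (fun u => ?_) (fun u => ?_) h1
    all_goals
      have h0 : 0 ≤ Real.pi / 2 - Real.arctan u := by
        linarith [Real.arctan_lt_pi_div_two u]
      have h5 : Real.exp (-b * u ^ 2) ≤ 1 := by
        rw [Real.exp_le_one_iff]; nlinarith [mul_nonneg hb (sq_nonneg u)]
      have h6 := Real.exp_pos (-b * u ^ 2)
    · exact mul_nonneg h0 (by linarith)
    · exact mul_le_of_le_one_right h0 (by linarith)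
  have hJI : IntegrableOn (fun u : ℝ => (1 + u ^ 2)⁻¹ - Real.exp (-b * u ^ 2) * (1 + u ^ 2)⁻¹)
    (Set.Ioi 0) := hJ.sub hI
  have hFTC := integral_Ioi_of_hasDerivAt_of_tendsto' hder (hK.sub hJI) hlim
  rw [integral_sub hK hJI, integral_sub hJ hI, h] at hFTC
  have hle : ∫ u in Set.Ioi (0:ℝ), (u * (Real.pi / 2 - Real.arctan u)) *
      (2 * b * Real.exp (-b * u ^ 2)) ≤ ∫ u in Set.Ioi (0:ℝ), 2 * b * Real.exp (-b * u ^ 2) := by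
    refine setIntegral_mono_on hK hg measurableSet_Ioi fun u hu => ?_
    exact mul_le_of_le_one_left (by positivity) (aux_arctan u hu)
  have hval : ∫ u in Set.Ioi (0:ℝ), 2 * b * Real.exp (-b * u ^ 2) = Real.sqrt (Real.pi * b) := by
    rw [integral_const_mul, integral_gaussian_Ioi]
    have : Real.pi * b = b ^ 2 * (Real.pi / b) := by field_simp
    rw [this, Real.sqrt_mul (by positivity), Real.sqrt_sq hb]
    ring
  simp at hFTC
  simp at hle hval ⊢
  linarith

lemma aux_inner (t x y r : ℝ) (hr : 0 < r) (hrt : r < t) :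
    ∫ z : ℝ, heatKer (t - r) (y - z) * heatKer (t - r) (x - z) * heatKer r z ^ 2 =
      heatKer t x * heatKer t y * (Real.sqrt (t / (Real.pi * ((t - r) * r))) / 2 *
        Real.exp (-((x - y) ^ 2 / (4 * t)) * (r / (t - r)))) := by
  have hs : 0 < t - r := by linarith
  have ht : 0 < t := by linarith
  obtain ⟨s, hsdef⟩ : ∃ s, s = t - r := ⟨_, rfl⟩
  rw [← hsdef] at hs ⊢
  have hts : t = s + r := by linarith
  have hfun : ∀ z : ℝ, heatKer s (y - z) * heatKer s (x - z) * heatKer r z ^ 2 =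
      (1 / (2 * Real.pi * s) * (1 / (2 * Real.pi * r)) *
        Real.exp (-((x + y) / 2) ^ 2 / t - (x - y) ^ 2 / (4 * s))) *
      Real.exp (-(t / (s * r)) * (z - (x + y) / 2 * r / t) ^ 2) := by
    intro z
    simp only [heatKer, if_pos hs, if_pos hr]
    have e1 : Real.sqrt (2 * Real.pi * s) * Real.sqrt (2 * Real.pi * s) = 2 * Real.pi * s :=
      Real.mul_self_sqrt (by positivity)
    have e2 : Real.sqrt (2 * Real.pi * r) ^ 2 = 2 * Real.pi * r :=
      Real.sq_sqrt (by positivity)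
    rw [div_mul_div_comm, e1, div_pow, e2, ← Real.exp_add, pow_two (Real.exp _), ← Real.exp_add,
      mul_assoc (_ * _) (Real.exp _), ← Real.exp_add, div_mul_div_comm, ← Real.exp_add,
      div_mul_div_comm, div_mul_eq_mul_div, one_mul, one_mul]
    congr 2
    rw [hts]
    field_simp
    ring
  simp_rw [hfun]
  rw [integral_const_mul,
    integral_sub_right_eq_self (fun z => Real.exp (-(t / (s * r)) * z ^ 2)), integral_gaussian]
  simp only [heatKer, if_pos ht]
  have e1 : Real.sqrt (2 * Real.pi * t) * Real.sqrt (2 * Real.pi * t) = 2 * Real.pi * t :=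
      Real.mul_self_sqrt (by positivity)
  rw [div_mul_div_comm (Real.exp _), e1, ← Real.exp_add]
  have e3 : Real.sqrt (Real.pi / (t / (s * r))) =
      Real.pi * (s * r) / t * Real.sqrt (t / (Real.pi * (s * r))) := by
    rw [← Real.sqrt_sq (show 0 ≤ Real.pi * (s * r) / t by positivity),
      ← Real.sqrt_mul (by positivity)]
    congr 1
    field_simp
  have e4 : Real.exp (-((x + y) / 2) ^ 2 / t - (x - y) ^ 2 / (4 * s)) =
      Real.exp (-x ^ 2 / (2 * t) + -y ^ 2 / (2 * t)) *
        Real.exp (-((x - y) ^ 2 / (4 * t)) * (r / s)) := by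
    rw [← Real.exp_add]
    congr 1
    rw [hts]
    field_simp
    ring
  rw [e3, e4]
  field_simp
  try ring

lemma aux_subst (t b : ℝ) (ht : 0 < t) :
    ∫ r in Set.Ioo 0 t, (Real.sqrt (t / (Real.pi * ((t - r) * r))) / 2 *
        Real.exp (-b * (r / (t - r)))) =
      Real.sqrt (t / Real.pi) *
        ∫ u in Set.Ioi (0:ℝ), Real.exp (-b * u ^ 2) * (1 + u ^ 2)⁻¹ := by
  have himg : (fun u : ℝ => t * u ^ 2 / (1 + u ^ 2)) '' Set.Ioi 0 = Set.Ioo 0 t := by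
    ext r
    constructor
    · rintro ⟨u, hu, rfl⟩
      have hu' : 0 < u := hu
      refine ⟨by positivity, ?_⟩
      show t * u ^ 2 / (1 + u ^ 2) < t
      rw [div_lt_iff₀ (by positivity)]
      nlinarith
    · rintro ⟨h0, h1⟩
      have hs : 0 < t - r := by linarith
      refine ⟨Real.sqrt (r / (t - r)), Real.sqrt_pos.2 (by positivity), ?_⟩
      simp only
      rw [Real.sq_sqrt (by positivity)]
      field_simp
      ring
  have hinj : Set.InjOn (fun u : ℝ => t * u ^ 2 / (1 + u ^ 2)) (Set.Ioi 0) := by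
    intro u hu v hv h
    have hu' : 0 < u := hu
    have hv' : 0 < v := hv
    simp only at h
    rw [div_eq_div_iff (by positivity) (by positivity)] at h
    have : t * (u ^ 2 - v ^ 2) = 0 := by linarith
    have h2 : u ^ 2 = v ^ 2 := by
      rcases mul_eq_zero.1 this with h | h <;> linarith
    exact (sq_eq_sq₀ hu'.le hv'.le).1 h2
  have hd : ∀ u ∈ Set.Ioi (0:ℝ), HasDerivWithinAt (fun u : ℝ => t * u ^ 2 / (1 + u ^ 2))
      (2 * t * u / (1 + u ^ 2) ^ 2) (Set.Ioi 0) u := by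
    intro u _
    have hp : HasDerivAt (fun v : ℝ => v ^ 2) (2 * u) u := by simpa using hasDerivAt_pow 2 u
    have h1 := hp.const_mul t
    have h2 := hp.const_add 1
    have h3 := h1.div h2 (by positivity)
    refine HasDerivAt.hasDerivWithinAt ?_
    refine h3.congr_deriv ?_
    congr 1
    ring
  rw [← himg, integral_image_eq_integral_abs_deriv_smul measurableSet_Ioi hd hinj,
    ← integral_const_mul]
  refine setIntegral_congr_fun measurableSet_Ioi fun u hu => ?_
  have hu' : 0 < u := hu
  have hA : t - t * u ^ 2 / (1 + u ^ 2) = t / (1 + u ^ 2) := by field_simp; ring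
  simp only [smul_eq_mul]
  rw [hA, abs_of_nonneg (by positivity)]
  have hB : t * u ^ 2 / (1 + u ^ 2) / (t / (1 + u ^ 2)) = u ^ 2 := by field_simp
  have hC : Real.sqrt (t / (Real.pi * (t / (1 + u ^ 2) * (t * u ^ 2 / (1 + u ^ 2))))) =
      (1 + u ^ 2) / (t * u) * Real.sqrt (t / Real.pi) := by
    rw [← Real.sqrt_sq (show 0 ≤ (1 + u ^ 2) / (t * u) by positivity),
      ← Real.sqrt_mul (by positivity)]
    congr 1
    field_simp
  rw [hB, hC]
  field_simp

/-- Lemma C.5 (lem:xybd): for `t > 0` and `x, y ∈ ℝ`,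
`(√(πt)/2 − |x−y|/2) ρ(t,x) ρ(t,y)
  ≤ ∫₀ᵗ ∫_ℝ ρ(t−r, y−z) ρ(t−r, x−z) ρ(r, z)² dz dr
  ≤ (√(πt)/2) ρ(t,x) ρ(t,y)`. -/
theorem stmt4 (t x y : ℝ) (ht : 0 < t) :
    (Real.sqrt (Real.pi * t) / 2 - |x - y| / 2) * heatKer t x * heatKer t y ≤
      (∫ r in (0:ℝ)..t, ∫ z : ℝ,
        heatKer (t - r) (y - z) * heatKer (t - r) (x - z) * heatKer r z ^ 2) ∧
    (∫ r in (0:ℝ)..t, ∫ z : ℝ,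
        heatKer (t - r) (y - z) * heatKer (t - r) (x - z) * heatKer r z ^ 2) ≤
      Real.sqrt (Real.pi * t) / 2 * heatKer t x * heatKer t y := by
  have hval : (∫ r in (0:ℝ)..t, ∫ z : ℝ,
        heatKer (t - r) (y - z) * heatKer (t - r) (x - z) * heatKer r z ^ 2) =
      heatKer t x * heatKer t y * (Real.sqrt (t / Real.pi) *
        ∫ u in Set.Ioi (0:ℝ), Real.exp (-((x - y) ^ 2 / (4 * t)) * u ^ 2) * (1 + u ^ 2)⁻¹) := by
    rw [← aux_subst t _ ht, ← integral_const_mul, intervalIntegral.integral_of_le ht.le,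
      integral_Ioc_eq_integral_Ioo]
    exact setIntegral_congr_fun measurableSet_Ioo fun r hr => aux_inner t x y r hr.1 hr.2
  have hb : 0 ≤ (x - y) ^ 2 / (4 * t) := by positivity
  have hρ : 0 ≤ heatKer t x * heatKer t y := by
    simp only [heatKer, if_pos ht]
    positivity
  have hup : Real.sqrt (t / Real.pi) * (Real.pi / 2) = Real.sqrt (Real.pi * t) / 2 := by
    have : Real.pi * t = Real.pi ^ 2 * (t / Real.pi) := by field_simp
    rw [this, Real.sqrt_mul (by positivity), Real.sqrt_sq Real.pi_pos.le]
    ring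
  have hlo : Real.sqrt (t / Real.pi) * Real.sqrt (Real.pi * ((x - y) ^ 2 / (4 * t))) =
      |x - y| / 2 := by
    rw [← Real.sqrt_mul (by positivity)]
    have : t / Real.pi * (Real.pi * ((x - y) ^ 2 / (4 * t))) = ((x - y) / 2) ^ 2 := by
      field_simp
      ring
    rw [this, Real.sqrt_sq_eq_abs, abs_div, abs_two]
  have hq := Real.sqrt_nonneg (t / Real.pi)
  rw [hval, mul_assoc (_ - _), mul_assoc (Real.sqrt (Real.pi * t) / 2), mul_comm (_ - _),
    mul_comm (Real.sqrt (Real.pi * t) / 2)]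
  constructor
  · refine mul_le_mul_of_nonneg_left ?_ hρ
    rw [← hup, ← hlo, ← mul_sub]
    exact mul_le_mul_of_nonneg_left (aux_lower _ hb) hq
  · refine mul_le_mul_of_nonneg_left ?_ hρ
    rw [← hup]
    exact mul_le_mul_of_nonneg_left (aux_upper _ hb) hq
end

section
/- For all real numbers t > 0 and x, y ∈ ℝ: ∫₀ᵗ ∫_ℝ ( ρ(t−r, y−z)·ρ(r, z)/ρ(t, y) − ρ(t−r, x−z)·ρ(r, z)/ρ(t, x) )² dz dr ≤ |x − y|. -/
open MeasureTheory

lemma heat_ratio (t r y z : ℝ) (hr : 0 < r) (hrt : r < t) :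
    heatKer (t - r) (y - z) * heatKer r z / heatKer t y =
      Real.exp (-(z - r * y / t) ^ 2 / (2 * (r * (t - r) / t))) /
        Real.sqrt (2 * Real.pi * (r * (t - r) / t)) := by
  have ht : 0 < t := hr.trans hrt
  have hs : 0 < t - r := sub_pos.2 hrt
  have hpi := Real.pi_pos
  unfold heatKer
  rw [if_pos hs, if_pos hr, if_pos ht]
  have h1 : Real.sqrt (2 * Real.pi * (t - r)) * Real.sqrt (2 * Real.pi * r) =
      Real.sqrt (2 * Real.pi * (r * (t - r) / t)) * Real.sqrt (2 * Real.pi * t) := by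
    rw [← Real.sqrt_mul (by positivity), ← Real.sqrt_mul (by positivity)]
    congr 1
    field_simp
  have h2 : Real.exp (-(y - z) ^ 2 / (2 * (t - r))) * Real.exp (-z ^ 2 / (2 * r)) =
      Real.exp (-(z - r * y / t) ^ 2 / (2 * (r * (t - r) / t))) *
        Real.exp (-y ^ 2 / (2 * t)) := by
    rw [← Real.exp_add, ← Real.exp_add]
    congr 1
    have := hs.ne'
    field_simp
    ring
  have p1 : 0 < Real.sqrt (2 * Real.pi * (t - r)) := by positivity
  have p2 : 0 < Real.sqrt (2 * Real.pi * r) := by positivity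
  have p3 : 0 < Real.sqrt (2 * Real.pi * (r * (t - r) / t)) := by positivity
  have p4 : 0 < Real.sqrt (2 * Real.pi * t) := by positivity
  rw [div_mul_div_comm, h1, h2]
  have := Real.exp_pos (-y ^ 2 / (2 * t))
  field_simp

lemma gauss_shift (v c : ℝ) (hv : 0 < v) :
    Integrable (fun z : ℝ => Real.exp (-(z - c) ^ 2 / v)) ∧
    ∫ z : ℝ, Real.exp (-(z - c) ^ 2 / v) = Real.sqrt (Real.pi * v) := by
  have h0 : (fun z : ℝ => Real.exp (-(z - c) ^ 2 / v)) =
      fun z => (fun w : ℝ => Real.exp (-(1 / v) * w ^ 2)) (z - c) := by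
    funext z
    simp only
    congr 1
    ring
  rw [h0]
  refine ⟨(integrable_exp_neg_mul_sq (by positivity)).comp_sub_right c, ?_⟩
  rw [integral_sub_right_eq_self (fun w : ℝ => Real.exp (-(1 / v) * w ^ 2)) c,
    integral_gaussian]
  congr 1
  field_simp

lemma gauss_diff (v m n : ℝ) (hv : 0 < v) :
    ∫ z : ℝ, (Real.exp (-(z - m) ^ 2 / (2 * v)) / Real.sqrt (2 * Real.pi * v) -
      Real.exp (-(z - n) ^ 2 / (2 * v)) / Real.sqrt (2 * Real.pi * v)) ^ 2 =
    (1 - Real.exp (-(m - n) ^ 2 / (4 * v))) / Real.sqrt (Real.pi * v) := by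
  have hpi := Real.pi_pos
  have key : ∀ z : ℝ, (Real.exp (-(z - m) ^ 2 / (2 * v)) / Real.sqrt (2 * Real.pi * v) -
      Real.exp (-(z - n) ^ 2 / (2 * v)) / Real.sqrt (2 * Real.pi * v)) ^ 2 =
      (1 / (2 * Real.pi * v)) * (Real.exp (-(z - m) ^ 2 / v) + Real.exp (-(z - n) ^ 2 / v)
        - (2 * Real.exp (-(m - n) ^ 2 / (4 * v))) * Real.exp (-(z - (m + n) / 2) ^ 2 / v)) := by
    intro z
    have e1 : Real.exp (-(z - m) ^ 2 / v) = Real.exp (-(z - m) ^ 2 / (2 * v)) ^ 2 := by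
      rw [← Real.exp_nat_mul]; congr 1; push_cast; field_simp
    have e2 : Real.exp (-(z - n) ^ 2 / v) = Real.exp (-(z - n) ^ 2 / (2 * v)) ^ 2 := by
      rw [← Real.exp_nat_mul]; congr 1; push_cast; field_simp
    have e3 : Real.exp (-(m - n) ^ 2 / (4 * v)) * Real.exp (-(z - (m + n) / 2) ^ 2 / v) =
        Real.exp (-(z - m) ^ 2 / (2 * v)) * Real.exp (-(z - n) ^ 2 / (2 * v)) := by
      rw [← Real.exp_add, ← Real.exp_add]; congr 1; field_simp; ring
    rw [mul_assoc 2 (Real.exp _), e1, e2, e3, ← sub_div, div_pow, Real.sq_sqrt (by positivity)]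
    ring
  simp_rw [key]
  obtain ⟨i1, j1⟩ := gauss_shift v m hv
  obtain ⟨i2, j2⟩ := gauss_shift v n hv
  obtain ⟨i3, j3⟩ := gauss_shift v ((m + n) / 2) hv
  have i12 : Integrable (fun z : ℝ => Real.exp (-(z - m) ^ 2 / v) +
      Real.exp (-(z - n) ^ 2 / v)) := i1.add i2
  rw [integral_const_mul, integral_sub i12 (i3.const_mul _), integral_add i1 i2,
    integral_const_mul, j1, j2, j3]
  have h : Real.sqrt (Real.pi * v) ^ 2 = Real.pi * v := Real.sq_sqrt (by positivity)
  have hp : 0 < Real.sqrt (Real.pi * v) := by positivity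
  rw [mul_assoc 2 Real.pi v]
  generalize Real.sqrt (Real.pi * v) = q at h hp
  rw [← h]
  field_simp
  ring

lemma bound_int (b : ℝ) (hb : 0 < b) :
    IntegrableOn (fun s : ℝ => (1 - Real.exp (-b * s ^ 2)) / s ^ 2) (Set.Ioi 0) ∧
    ∫ s in Set.Ioi (0:ℝ), (1 - Real.exp (-b * s ^ 2)) / s ^ 2 = Real.sqrt (Real.pi * b) := by
  have hcont : Continuous (fun σ : ℝ => Real.exp (-b * σ ^ 2)) := by fun_prop
  set H : ℝ → ℝ := fun s => -((1 - Real.exp (-b * s ^ 2)) / s) +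
    2 * b * ∫ σ in (0:ℝ)..s, Real.exp (-b * σ ^ 2) with hH
  have hprim : ∀ s : ℝ, HasDerivAt (fun s => ∫ σ in (0:ℝ)..s, Real.exp (-b * σ ^ 2))
      (Real.exp (-b * s ^ 2)) s := fun s =>
    intervalIntegral.integral_hasDerivAt_right (hcont.intervalIntegrable _ _)
      (hcont.stronglyMeasurableAtFilter _ _) hcont.continuousAt
  have hpos : ∀ s : ℝ, 0 ≤ 1 - Real.exp (-b * s ^ 2) := fun s => by
    have : Real.exp (-b * s ^ 2) ≤ 1 := Real.exp_le_one_iff.2 (by nlinarith [sq_nonneg s])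
    linarith
  have hderiv : ∀ s ∈ Set.Ioi (0:ℝ),
      HasDerivAt H ((1 - Real.exp (-b * s ^ 2)) / s ^ 2) s := by
    intro s hs
    have hs : 0 < s := hs
    have h1 : HasDerivAt (fun s : ℝ => -b * s ^ 2) (-b * (2 * s)) s := by
      simpa using (hasDerivAt_pow 2 s).const_mul (-b)
    have h2 := ((h1.exp.const_sub 1).div (hasDerivAt_id s) hs.ne').neg.add
      ((hprim s).const_mul (2 * b))
    refine h2.congr_deriv ?_
    simp only [id]
    field_simp
    ring
  have hle : ∀ s : ℝ, 0 ≤ s → (1 - Real.exp (-b * s ^ 2)) / s ≤ b * s := by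
    intro s hs
    rcases hs.eq_or_lt with rfl | hs
    · simp
    rw [div_le_iff₀ hs]
    have := Real.add_one_le_exp (-b * s ^ 2)
    nlinarith
  have hc0 : ContinuousWithinAt H (Set.Ici 0) 0 := by
    apply ContinuousWithinAt.add
    · apply ContinuousWithinAt.neg
      unfold ContinuousWithinAt
      have hz : (1 - Real.exp (-b * (0:ℝ) ^ 2)) / 0 = 0 := by simp
      beta_reduce
      rw [hz]
      have hb0 : Filter.Tendsto (fun s : ℝ => b * s) (nhdsWithin 0 (Set.Ici 0)) (nhds 0) := by
        have : Continuous (fun s : ℝ => b * s) := by fun_prop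
        simpa using (this.tendsto 0).mono_left nhdsWithin_le_nhds
      refine tendsto_of_tendsto_of_tendsto_of_le_of_le' tendsto_const_nhds hb0 ?_ ?_
      · filter_upwards [self_mem_nhdsWithin] with s hs
        exact div_nonneg (hpos s) hs
      · filter_upwards [self_mem_nhdsWithin] with s hs
        exact hle s hs
    · exact ((hprim 0).continuousAt.const_mul (2 * b)).continuousWithinAt
  have hlim : Filter.Tendsto H Filter.atTop (nhds (Real.sqrt (Real.pi * b))) := by
    have l1 : Filter.Tendsto (fun s : ℝ => (1 - Real.exp (-b * s ^ 2)) / s)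
        Filter.atTop (nhds 0) := by
      refine tendsto_of_tendsto_of_tendsto_of_le_of_le' tendsto_const_nhds
        tendsto_inv_atTop_zero ?_ ?_
      · filter_upwards [Filter.eventually_gt_atTop 0] with s hs
        exact div_nonneg (hpos s) hs.le
      · filter_upwards [Filter.eventually_gt_atTop 0] with s hs
        rw [inv_eq_one_div]
        gcongr
        linarith [Real.exp_pos (-b * s ^ 2)]
    have l2 := intervalIntegral_tendsto_integral_Ioi (f := fun σ : ℝ => Real.exp (-b * σ ^ 2)) 0
      (integrable_exp_neg_mul_sq hb).integrableOn Filter.tendsto_id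
    rw [integral_gaussian_Ioi] at l2
    have l3 := l1.neg.add (l2.const_mul (2 * b))
    have e : -0 + 2 * b * (Real.sqrt (Real.pi / b) / 2) = Real.sqrt (Real.pi * b) := by
      have : Real.pi * b = (Real.pi / b) * b ^ 2 := by field_simp
      rw [this, Real.sqrt_mul (by positivity), Real.sqrt_sq hb.le]
      ring
    rw [e] at l3
    exact l3
  have hnn : ∀ s ∈ Set.Ioi (0:ℝ), 0 ≤ (1 - Real.exp (-b * s ^ 2)) / s ^ 2 := fun s _ =>
    div_nonneg (hpos s) (sq_nonneg s)
  refine ⟨integrableOn_Ioi_deriv_of_nonneg hc0 hderiv hnn hlim, ?_⟩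
  rw [integral_Ioi_of_hasDerivAt_of_nonneg hc0 hderiv hnn hlim]
  simp [hH]

theorem cov (t : ℝ) (ht : 0 < t) (g : ℝ → ℝ) :
    ∫ r in (0:ℝ)..t, g r =
      ∫ s in Set.Ioi (0:ℝ), (2 * t * s / (1 + s ^ 2) ^ 2) * g (t * s ^ 2 / (1 + s ^ 2)) := by
  have hd : ∀ s ∈ Set.Ioi (0:ℝ), HasDerivWithinAt (fun s : ℝ => t * s ^ 2 / (1 + s ^ 2))
      (2 * t * s / (1 + s ^ 2) ^ 2) (Set.Ioi 0) s := by
    intro s _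
    have hne : 1 + s ^ 2 ≠ 0 := by positivity
    have h := (((hasDerivAt_pow 2 s).const_mul t).div ((hasDerivAt_pow 2 s).const_add 1) hne)
    refine (h.congr_deriv ?_).hasDerivWithinAt
    simp only [Nat.cast_ofNat]
    field_simp
    ring
  have hinj : Set.InjOn (fun s : ℝ => t * s ^ 2 / (1 + s ^ 2)) (Set.Ioi 0) := by
    intro a ha b hb hab
    have ha : 0 < a := ha
    have hb : 0 < b := hb
    simp only at hab
    rw [div_eq_div_iff (by positivity) (by positivity)] at hab
    have h2 : t * (a ^ 2 - b ^ 2) = 0 := by linarith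
    have h3 : a ^ 2 - b ^ 2 = 0 := by simpa [ht.ne'] using h2
    exact (pow_left_inj₀ ha.le hb.le two_ne_zero).1 (by linarith)
  have himg : (fun s : ℝ => t * s ^ 2 / (1 + s ^ 2)) '' Set.Ioi 0 = Set.Ioo 0 t := by
    ext r
    constructor
    · rintro ⟨s, hs, rfl⟩
      have hs : 0 < s := hs
      refine ⟨by positivity, ?_⟩
      simp only
      rw [div_lt_iff₀ (by positivity)]
      linarith
    · rintro ⟨h0, h1⟩
      have h2 : 0 < t - r := sub_pos.2 h1
      refine ⟨Real.sqrt (r / (t - r)), Real.sqrt_pos.2 (by positivity), ?_⟩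
      simp only
      rw [Real.sq_sqrt (by positivity)]
      field_simp
      ring
  rw [intervalIntegral.integral_of_le ht.le, integral_Ioc_eq_integral_Ioo, ← himg,
    integral_image_eq_integral_abs_deriv_smul measurableSet_Ioi hd hinj]
  refine setIntegral_congr_fun measurableSet_Ioi fun s hs => ?_
  have hs : 0 < s := hs
  simp only [smul_eq_mul]
  rw [abs_of_nonneg (by positivity)]

/-- Corollary C.6: for `t > 0` and `x, y ∈ ℝ`,
`∫₀ᵗ ∫_ℝ (ρ(t−r,y−z) ρ(r,z)/ρ(t,y) − ρ(t−r,x−z) ρ(r,z)/ρ(t,x))² dz dr ≤ |x − y|`. -/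
theorem stmt5 (t x y : ℝ) (ht : 0 < t) :
    (∫ r in (0:ℝ)..t, ∫ z : ℝ,
        (heatKer (t - r) (y - z) * heatKer r z / heatKer t y -
          heatKer (t - r) (x - z) * heatKer r z / heatKer t x) ^ 2) ≤ |x - y| := by
  rcases eq_or_ne x y with rfl | hxy
  · simp
  have hpi := Real.pi_pos
  have hxy2 : 0 < (x - y) ^ 2 := by
    have := sub_ne_zero.2 hxy
    positivity
  set b : ℝ := (x - y) ^ 2 / (4 * t) with hb
  have hbpos : 0 < b := by positivity
  obtain ⟨hi, hv⟩ := bound_int b hbpos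
  rw [cov t ht]
  have hpt : 0 < Real.sqrt (Real.pi * t) := by positivity
  have hsq : Real.sqrt (Real.pi * t) ^ 2 = Real.pi * t := Real.sq_sqrt (by positivity)
  have step : ∀ s ∈ Set.Ioi (0:ℝ), (2 * t * s / (1 + s ^ 2) ^ 2) * (∫ z : ℝ,
        (heatKer (t - t * s ^ 2 / (1 + s ^ 2)) (y - z) * heatKer (t * s ^ 2 / (1 + s ^ 2)) z
            / heatKer t y -
          heatKer (t - t * s ^ 2 / (1 + s ^ 2)) (x - z) * heatKer (t * s ^ 2 / (1 + s ^ 2)) z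
            / heatKer t x) ^ 2) =
      (2 * t / Real.sqrt (Real.pi * t)) * ((1 - Real.exp (-b * s ^ 2)) / (1 + s ^ 2)) := by
    intro s hs
    have hs : 0 < s := hs
    have hr : 0 < t * s ^ 2 / (1 + s ^ 2) := by positivity
    have hrt : t * s ^ 2 / (1 + s ^ 2) < t := by
      rw [div_lt_iff₀ (by positivity)]; linarith
    have hvv : t * s ^ 2 / (1 + s ^ 2) * (t - t * s ^ 2 / (1 + s ^ 2)) / t =
        t * (s / (1 + s ^ 2)) ^ 2 := by
      field_simp
      ring
    simp_rw [heat_ratio t _ _ _ hr hrt, hvv]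
    rw [gauss_diff _ _ _ (by positivity)]
    have e1 : -(t * s ^ 2 / (1 + s ^ 2) * y / t - t * s ^ 2 / (1 + s ^ 2) * x / t) ^ 2 /
        (4 * (t * (s / (1 + s ^ 2)) ^ 2)) = -b * s ^ 2 := by
      rw [hb]
      field_simp
      ring
    rw [e1, ← mul_assoc Real.pi, Real.sqrt_mul (by positivity) ((s / (1 + s ^ 2)) ^ 2),
      Real.sqrt_sq (by positivity)]
    field_simp
  rw [setIntegral_congr_fun measurableSet_Ioi step]
  have hpos : ∀ s : ℝ, 0 ≤ 1 - Real.exp (-b * s ^ 2) := fun s => by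
    have : Real.exp (-b * s ^ 2) ≤ 1 := Real.exp_le_one_iff.2 (by nlinarith [sq_nonneg s])
    linarith
  have hmono : ∫ s in Set.Ioi (0:ℝ), (1 - Real.exp (-b * s ^ 2)) / (1 + s ^ 2) ≤
      ∫ s in Set.Ioi (0:ℝ), (1 - Real.exp (-b * s ^ 2)) / s ^ 2 := by
    refine integral_mono_of_nonneg ?_ hi ?_
    · exact Filter.Eventually.of_forall fun s => div_nonneg (hpos s) (by positivity)
    · filter_upwards [ae_restrict_mem measurableSet_Ioi] with s hs
      have hs : 0 < s := hs
      exact div_le_div_of_nonneg_left (hpos s) (by positivity) (by linarith)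
  rw [integral_const_mul]
  calc _ ≤ (2 * t / Real.sqrt (Real.pi * t)) * Real.sqrt (Real.pi * b) := by
        rw [← hv]
        exact mul_le_mul_of_nonneg_left hmono (by positivity)
    _ = |x - y| := by
        have : Real.pi * b = Real.pi * t * (|x - y| / (2 * t)) ^ 2 := by
          rw [hb, div_pow, sq_abs]
          field_simp
          ring
        rw [this, Real.sqrt_mul (by positivity) ((|x - y| / (2 * t)) ^ 2),
          Real.sqrt_sq (by positivity)]
        field_simp
end

section
/- For all real numbers t > 0, h > 0, r with 0 < r < t, and x ∈ ℝ, setting D = (t+h)·(t−r) + t·(t+h−r), the following identity holds: ∫_ℝ ρ(t+h−r, x−z) · ρ(t−r, x−z) · ρ(r, z)² dz = ρ(t+h, x) · ρ(t, x) · ( √(t·(t+h)) / √(2π·r·D) ) · exp( − x²·h²·r / (2·t·(t+h)·D) ). -/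
open MeasureTheory

lemma aux_prefactor (a b r : ℝ) (ha : 0 < a) (hb : 0 < b) (hr : 0 < r) (D : ℝ) (hD : 0 < D) :
    1 / (√(2 * Real.pi * a) * √(2 * Real.pi * b) * √(2 * Real.pi * r) ^ 2)
      * √(Real.pi / (D / (2 * a * b * r)))
    = 1 / (√(2 * Real.pi * (a + r)) * √(2 * Real.pi * (b + r))) *
      (√((b + r) * (a + r)) / √(2 * Real.pi * r * D)) := by
  have hp := Real.pi_pos
  have e : Real.pi / (D / (2 * a * b * r)) = (2 * Real.pi * r) * a * b / D := by
    field_simp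
  rw [e, Real.sqrt_div (by positivity), Real.sqrt_mul (by positivity) b,
    Real.sqrt_mul (by positivity) a, Real.sqrt_mul (by positivity) (a + r),
    Real.sqrt_mul (by positivity) (b + r), Real.sqrt_mul (by positivity) D,
    Real.sqrt_mul (by positivity) (a + r),
    Real.sqrt_mul (by positivity : 0 ≤ 2 * Real.pi * r * a) b,
    Real.sqrt_mul (by positivity : 0 ≤ 2 * Real.pi * r) a]
  have h1 : 0 < √(2 * Real.pi) := by positivity
  have h2 : 0 < √(2 * Real.pi * r) := by positivity
  have h3 : 0 < √a := by positivity
  have h4 : 0 < √b := by positivity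
  have h5 : 0 < √D := by positivity
  have h6 : 0 < √(a + r) := by positivity
  have h7 : 0 < √(b + r) := by positivity
  field_simp

lemma aux_main (a b r x : ℝ) (ha : 0 < a) (hb : 0 < b) (hr : 0 < r) (D : ℝ)
    (hD : D = 2 * a * b + r * (a + b)) :
    ∫ z : ℝ, heatKer a (x - z) * heatKer b (x - z) * heatKer r z ^ 2 =
      heatKer (a + r) x * heatKer (b + r) x *
        (√((b + r) * (a + r)) / √(2 * Real.pi * r * D)) *
        Real.exp (-(x ^ 2 * (a - b) ^ 2 * r) / (2 * (b + r) * (a + r) * D)) := by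
  have hD0 : 0 < D := by rw [hD]; positivity
  have har : 0 < a + r := by positivity
  have hbr : 0 < b + r := by positivity
  simp only [heatKer, ha, hb, hr, har, hbr, if_true]
  have key : ∀ z : ℝ, Real.exp (-(x - z) ^ 2 / (2 * a)) / √(2 * Real.pi * a) *
      (Real.exp (-(x - z) ^ 2 / (2 * b)) / √(2 * Real.pi * b)) *
      (Real.exp (-z ^ 2 / (2 * r)) / √(2 * Real.pi * r)) ^ 2 =
      (1 / (√(2 * Real.pi * a) * √(2 * Real.pi * b) * √(2 * Real.pi * r) ^ 2) *
        Real.exp (-(x ^ 2 * (a + b) / D))) *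
        Real.exp (-(D / (2 * a * b * r)) * (z - x * r * (a + b) / D) ^ 2) := by
    intro z
    have e : Real.exp (-(x ^ 2 * (a + b) / D)) *
        Real.exp (-(D / (2 * a * b * r)) * (z - x * r * (a + b) / D) ^ 2) =
        Real.exp (-(x - z) ^ 2 / (2 * a)) * Real.exp (-(x - z) ^ 2 / (2 * b)) *
          Real.exp (-z ^ 2 / (2 * r)) ^ 2 := by
      rw [pow_two (Real.exp (-z ^ 2 / (2 * r))), ← Real.exp_add, ← Real.exp_add,
        ← Real.exp_add, ← Real.exp_add]
      congr 1
      field_simp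
      rw [hD]
      ring
    rw [mul_assoc (1 / _), e, div_pow]
    ring
  simp_rw [key]
  rw [integral_const_mul,
    integral_sub_right_eq_self (fun z : ℝ => Real.exp (-(D / (2 * a * b * r)) * z ^ 2)),
    integral_gaussian]
  have e2 : Real.exp (-(x ^ 2 * (a + b) / D)) =
      Real.exp (-x ^ 2 / (2 * (a + r))) * Real.exp (-x ^ 2 / (2 * (b + r))) *
        Real.exp (-(x ^ 2 * (a - b) ^ 2 * r) / (2 * (b + r) * (a + r) * D)) := by
    rw [← Real.exp_add, ← Real.exp_add]
    congr 1
    field_simp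
    rw [hD]
    ring
  rw [mul_right_comm, aux_prefactor a b r ha hb hr D hD0, e2]
  ring

/-- Lemma C.7 (lem:diffhspace): for `t > 0`, `h > 0`, `0 < r < t`, `x ∈ ℝ`, with
`D = (t+h)(t−r) + t(t+h−r)`:
`∫_ℝ ρ(t+h−r, x−z) ρ(t−r, x−z) ρ(r, z)² dz
  = ρ(t+h, x) ρ(t, x) (√(t(t+h)) / √(2πrD)) exp(−x²h²r/(2t(t+h)D))`. -/
theorem stmt6 (t h r x : ℝ) (ht : 0 < t) (hh : 0 < h) (hr : 0 < r) (hrt : r < t) :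
    ∫ z : ℝ, heatKer (t + h - r) (x - z) * heatKer (t - r) (x - z) * heatKer r z ^ 2 =
      heatKer (t + h) x * heatKer t x *
        (Real.sqrt (t * (t + h)) /
          Real.sqrt (2 * Real.pi * r * ((t + h) * (t - r) + t * (t + h - r)))) *
        Real.exp (-(x ^ 2 * h ^ 2 * r) /
          (2 * t * (t + h) * ((t + h) * (t - r) + t * (t + h - r)))) := by
  have := aux_main (t + h - r) (t - r) r x (by linarith) (by linarith) hr
    ((t + h) * (t - r) + t * (t + h - r)) (by ring)
  rw [this]
  have e1 : t + h - r + r = t + h := by ring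
  have e2 : t - r + r = t := by ring
  have e3 : t + h - r - (t - r) = h := by ring
  rw [e1, e2, e3]
end

section
/- Let δ ∈ (0,1), T > 1, h ≥ 0 and t ∈ ℝ satisfy δ ≤ t ≤ t + h ≤ T, and let x ∈ ℝ. Then √(πt)/2 − (T/(δ·√π))·√h − h·(√π·T^{3/2}/(8·δ³))·x² ≤ ∫₀ᵗ ∫_ℝ ( ρ(t+h−r, x−z)·ρ(r,z)/ρ(t+h, x) ) · ( ρ(t−r, x−z)·ρ(r,z)/ρ(t, x) ) dz dr ≤ √(πt)/2. -/
open MeasureTheory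

lemma hk_pos {t : ℝ} (ht : 0 < t) (x : ℝ) : 0 < heatKer t x := by
  unfold heatKer
  rw [if_pos ht]
  have := Real.pi_pos
  positivity

lemma hk_mul {p q : ℝ} (hp : 0 < p) (hq : 0 < q) (x z : ℝ) :
    heatKer p (x - z) * heatKer q z
      = heatKer (p + q) x * heatKer (p * q / (p + q)) (z - x * q / (p + q)) := by
  have hpi := Real.pi_pos
  have hpq : 0 < p + q := by positivity
  have hv : 0 < p * q / (p + q) := by positivity
  unfold heatKer
  rw [if_pos hp, if_pos hq, if_pos hpq, if_pos hv, div_mul_div_comm, div_mul_div_comm,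
    ← Real.exp_add, ← Real.exp_add, ← Real.sqrt_mul (by positivity), ← Real.sqrt_mul (by positivity)]
  congr 2
  · field_simp
    ring
  · field_simp

lemma hk_integral {v : ℝ} (hv : 0 < v) (c : ℝ) : ∫ z : ℝ, heatKer v (z - c) = 1 := by
  have hpi := Real.pi_pos
  rw [integral_sub_right_eq_self (fun z => heatKer v z) c]
  unfold heatKer
  simp only [if_pos hv]
  rw [integral_div]
  have : (fun z : ℝ => Real.exp (-z ^ 2 / (2 * v))) = fun z => Real.exp (-(1 / (2 * v)) * z ^ 2) := by
    funext z
    congr 1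
    field_simp
  rw [this, integral_gaussian]
  have : Real.pi / (1 / (2 * v)) = 2 * Real.pi * v := by field_simp
  rw [this]
  exact div_self (by positivity)

lemma hk_even (v x : ℝ) : heatKer v (-x) = heatKer v x := by
  unfold heatKer
  simp

lemma inner_eq_s7 {r t s x : ℝ} (hr : 0 < r) (hrt : r < t) (hrs : r < s) :
    (∫ z : ℝ, (heatKer (s - r) (x - z) * heatKer r z / heatKer s x) *
          (heatKer (t - r) (x - z) * heatKer r z / heatKer t x))
      = heatKer ((s - r) * r / s + (t - r) * r / t) (x * r / s - x * r / t) := by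
  have h1 : ∀ u : ℝ, r < u → ∀ z, heatKer (u - r) (x - z) * heatKer r z / heatKer u x
      = heatKer ((u - r) * r / u) (z - x * r / u) := by
    intro u hu z
    rw [hk_mul (by linarith) hr, sub_add_cancel]
    have := hk_pos (show 0 < u by linarith) x
    field_simp
  have hs : 0 < (s - r) * r / s := div_pos (mul_pos (by linarith) hr) (by linarith)
  have ht : 0 < (t - r) * r / t := div_pos (mul_pos (by linarith) hr) (by linarith)
  simp only [h1 s hrs, h1 t hrt]
  set p := (s - r) * r / s
  set q := (t - r) * r / t
  set m := x * r / s
  set n := x * r / t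
  have h2 : ∀ z, heatKer p (z - m) * heatKer q (z - n)
      = heatKer (p + q) (m - n) * heatKer (p * q / (p + q)) (z - (n + (m - n) * q / (p + q))) := by
    intro z
    rw [← hk_even p (z - m), show -(z - m) = (m - n) - (z - n) by ring, hk_mul hs ht]
    congr 2
    ring
  simp only [h2]
  rw [integral_const_mul, hk_integral (by positivity), mul_one]

/-- Antiderivative facts for `1/√(r(1-ar))`. -/
lemma g_deriv {a r : ℝ} (ha : 0 < a) (hr : 0 < r) (har : a * r < 1) :
    HasDerivAt (fun r => Real.arcsin (2 * a * r - 1) / Real.sqrt a)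
      (1 / Real.sqrt (r * (1 - a * r))) r := by
  have har0 : 0 < a * r := by positivity
  have h1 : HasDerivAt (fun r => 2 * a * r - 1) (2 * a) r := by
    simpa using ((hasDerivAt_id r).const_mul (2 * a)).sub_const 1
  have h2 := (Real.hasDerivAt_arcsin (x := 2 * a * r - 1) (by nlinarith) (by nlinarith)).comp r h1
  have h3 := h2.div_const (Real.sqrt a)
  refine h3.congr_deriv ?_
  have hp : 0 < r * (1 - a * r) := mul_pos hr (by linarith)
  have e : 1 - (2 * a * r - 1) ^ 2 = (2 : ℝ) ^ 2 * (a * (r * (1 - a * r))) := by ring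
  rw [e, Real.sqrt_mul (by positivity), Real.sqrt_sq (by norm_num), Real.sqrt_mul ha.le]
  have hsa := Real.sqrt_pos.2 ha
  have hsp := Real.sqrt_pos.2 hp
  field_simp
  rw [Real.sq_sqrt ha.le]

lemma g_cont (a t : ℝ) : ContinuousOn (fun r => Real.arcsin (2 * a * r - 1) / Real.sqrt a)
    (Set.Icc 0 t) := by
  have := Real.continuous_arcsin
  fun_prop

lemma g_int {a t : ℝ} (ha : 0 < a) (ht : 0 < t) (hat : a * t ≤ 1) :
    IntervalIntegrable (fun r => 1 / Real.sqrt (r * (1 - a * r))) volume 0 t := by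
  rw [intervalIntegrable_iff_integrableOn_Ioc_of_le ht.le]
  apply intervalIntegral.integrableOn_deriv_of_nonneg (g_cont a t)
  · intro r hr
    exact g_deriv ha hr.1 (by nlinarith [hr.2])
  · intro r hr
    positivity

lemma g_val {a t : ℝ} (ha : 0 < a) (ht : 0 < t) (hat : a * t ≤ 1) :
    ∫ r in (0:ℝ)..t, 1 / Real.sqrt (r * (1 - a * r))
      = (Real.arcsin (2 * a * t - 1) + Real.pi / 2) / Real.sqrt a := by
  rw [intervalIntegral.integral_eq_sub_of_hasDerivAt_of_le ht.le (g_cont a t)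
    (fun r hr => g_deriv ha hr.1 (by nlinarith [hr.2])) (g_int ha ht hat)]
  simp
  ring

lemma g1_val {t : ℝ} (ht : 0 < t) :
    ∫ r in (0:ℝ)..t, 1 / Real.sqrt (r * (1 - 1 / t * r)) = Real.pi * Real.sqrt t := by
  rw [g_val (by positivity) ht (by field_simp; rfl)]
  have : 2 * (1 / t) * t - 1 = 1 := by field_simp; norm_num
  rw [this, Real.arcsin_one]
  simp

lemma g2_int {t : ℝ} (ht : 0 < t) :
    IntervalIntegrable (fun r => r * (1 / Real.sqrt (r * (1 - 1 / t * r)))) volume 0 t :=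
  (g_int (by positivity) ht (by field_simp; rfl)).continuousOn_mul (by fun_prop)

lemma g2_val {t : ℝ} (ht : 0 < t) :
    ∫ r in (0:ℝ)..t, r * (1 / Real.sqrt (r * (1 - 1 / t * r)))
      = t / 2 * (Real.pi * Real.sqrt t) := by
  have h1 := intervalIntegral.integral_comp_sub_left (a := 0) (b := t)
    (fun r => r * (1 / Real.sqrt (r * (1 - 1 / t * r)))) t
  simp only [sub_self, sub_zero] at h1
  have h2 : ∀ r : ℝ, (t - r) * (1 / Real.sqrt ((t - r) * (1 - 1 / t * (t - r))))
      = t * (1 / Real.sqrt (r * (1 - 1 / t * r))) - r * (1 / Real.sqrt (r * (1 - 1 / t * r))) := by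
    intro r
    have : (t - r) * (1 - 1 / t * (t - r)) = r * (1 - 1 / t * r) := by field_simp; ring
    rw [this]; ring
  simp only [h2] at h1
  rw [intervalIntegral.integral_sub ((g_int (by positivity) ht (by field_simp; rfl)).const_mul t)
    (g2_int ht), intervalIntegral.integral_const_mul, g1_val ht] at h1
  linarith

lemma arcsin_bound {t h : ℝ} (ht : 0 < t) (hh : 0 ≤ h) :
    Real.pi / 2 - 2 * Real.sqrt (h / t) ≤ Real.arcsin (t / (t + h)) := by
  have hth : 0 < t + h := by positivity
  set θ := Real.arccos (t / (t + h)) with hθ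
  have hy0 : 0 ≤ t / (t + h) := by positivity
  have hy1 : t / (t + h) ≤ 1 := by rw [div_le_one hth]; linarith
  have h0 : 0 ≤ θ := Real.arccos_nonneg _
  have h1 : θ ≤ Real.pi / 2 := Real.arccos_le_pi_div_two.2 hy0
  have hc : Real.cos θ = t / (t + h) := Real.cos_arccos (by linarith) hy1
  have hb : Real.cos θ ≤ 1 - θ ^ 2 / 4 := by
    rcases h0.eq_or_lt with h | h
    · rw [← h]; simp
    have hs : θ / 2 - (θ / 2) ^ 3 / 6 < Real.sin (θ / 2) :=
      Real.sin_gt_sub_cube (by linarith)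
    have h4 : θ / 2 ≤ 1 := by linarith [Real.pi_lt_d2]
    have h5 : 3 / 4 * (θ / 2) ≤ Real.sin (θ / 2) := by nlinarith [mul_pos h h]
    have h6 : Real.cos θ = 1 - 2 * Real.sin (θ / 2) ^ 2 := by
      have := Real.cos_two_mul (θ / 2)
      rw [show 2 * (θ / 2) = θ by ring] at this
      nlinarith [Real.sin_sq_add_cos_sq (θ / 2)]
    nlinarith
  have h7 : θ ≤ 2 * Real.sqrt (h / t) := by
    have : θ / 2 ≤ Real.sqrt (h / t) := by
      apply Real.le_sqrt_of_sq_le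
      have e : h / (t + h) = 1 - t / (t + h) := by field_simp; ring
      have : h / (t + h) ≤ h / t := by gcongr; linarith
      nlinarith
    linarith
  have h8 : θ = Real.pi / 2 - Real.arcsin (t / (t + h)) := rfl
  linarith

lemma hk_V {V m : ℝ} (hV : 0 < V) : heatKer V m = Real.exp (-m ^ 2 / (2 * V)) / Real.sqrt (2 * Real.pi * V) := by
  unfold heatKer; rw [if_pos hV]

lemma pointwise {t h x r : ℝ} (ht : 0 < t) (hh : 0 ≤ h) (hr : 0 < r) (hrt : r < t) :
    let a := (1 / t + 1 / (t + h)) / 2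
    let F := heatKer ((t + h - r) * r / (t + h) + (t - r) * r / t) (x * r / (t + h) - x * r / t)
    F ≤ 1 / (2 * Real.sqrt Real.pi) * (1 / Real.sqrt (r * (1 - 1 / t * r))) ∧
    1 / (2 * Real.sqrt Real.pi) * (1 / Real.sqrt (r * (1 - a * r)))
      - x ^ 2 * h / (4 * Real.sqrt Real.pi * t ^ 2 * (t + h)) *
        (r * (1 / Real.sqrt (r * (1 - 1 / t * r)))) ≤ F := by
  intro a F
  have hpi := Real.pi_pos
  have hth : 0 < t + h := by positivity
  have hb : 0 < 1 - 1 / t * r := by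
    have : 1 / t * r < 1 := by field_simp; exact hrt
    linarith
  have hat : a ≤ 1 / t := by
    have : 1 / (t + h) ≤ 1 / t := one_div_le_one_div_of_le ht (by linarith)
    simp only [a]; linarith
  have hle : 1 - 1 / t * r ≤ 1 - a * r := by nlinarith
  have ha : 0 < 1 - a * r := by linarith
  have hah : h / (2 * (t + h)) ≤ 1 - a * r := by
    have e : h / (2 * (t + h)) = 1 - a * t := by simp only [a]; field_simp; ring
    have : 0 < a := by positivity
    rw [e]; nlinarith
  have hV : (t + h - r) * r / (t + h) + (t - r) * r / t = 2 * (r * (1 - a * r)) := by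
    simp only [a]; field_simp; ring
  have hVp : 0 < 2 * (r * (1 - a * r)) := by positivity
  have hG : 1 / Real.sqrt (r * (1 - a * r)) ≤ 1 / Real.sqrt (r * (1 - 1 / t * r)) := by
    gcongr
  have hsq : Real.sqrt (2 * Real.pi * (2 * (r * (1 - a * r))))
      = 2 * Real.sqrt Real.pi * Real.sqrt (r * (1 - a * r)) := by
    rw [show 2 * Real.pi * (2 * (r * (1 - a * r))) = 2 ^ 2 * Real.pi * (r * (1 - a * r)) by ring,
      Real.sqrt_mul (by positivity), Real.sqrt_mul (by positivity), Real.sqrt_sq (by norm_num)]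
  set q := (x * r / (t + h) - x * r / t) ^ 2 / (2 * (2 * (r * (1 - a * r)))) with hq
  set G := 1 / Real.sqrt (r * (1 - a * r)) with hGd
  set G1 := 1 / Real.sqrt (r * (1 - 1 / t * r)) with hG1d
  have hG0 : 0 ≤ G := by positivity
  have hF : F = Real.exp (-q) * (1 / (2 * Real.sqrt Real.pi) * G) := by
    simp only [F]
    rw [hV, hk_V hVp, hsq, neg_div, ← hq, hGd]
    clear_value q
    have := Real.sqrt_pos.2 hpi
    have : 0 < Real.sqrt (r * (1 - a * r)) := Real.sqrt_pos.2 (by positivity)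
    field_simp
  have hq0 : 0 ≤ q := by positivity
  have hc : 0 ≤ 1 / (2 * Real.sqrt Real.pi) := by positivity
  rw [hF]
  constructor
  · calc _ ≤ 1 * (1 / (2 * Real.sqrt Real.pi) * G) := by
          gcongr
          exact Real.exp_le_one_iff.2 (by linarith)
      _ ≤ _ := by rw [one_mul]; gcongr
  · have hqb : q ≤ x ^ 2 * h * r / (2 * t ^ 2 * (t + h)) := by
      rw [hq, div_le_iff₀ (by positivity)]
      have e : (x * r / (t + h) - x * r / t) ^ 2
        = x ^ 2 * h * r / (2 * t ^ 2 * (t + h)) * (2 * (2 * (r * (h / (2 * (t + h)))))) := by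
        field_simp; ring
      rw [e]
      gcongr
    have h1 : q * (1 / (2 * Real.sqrt Real.pi) * G) ≤
        x ^ 2 * h * r / (2 * t ^ 2 * (t + h)) * (1 / (2 * Real.sqrt Real.pi) * G1) := by
      gcongr
    have e : x ^ 2 * h * r / (2 * t ^ 2 * (t + h)) * (1 / (2 * Real.sqrt Real.pi) * G1)
      = x ^ 2 * h / (4 * Real.sqrt Real.pi * t ^ 2 * (t + h)) * (r * G1) := by
      have := Real.sqrt_pos.2 hpi
      field_simp; ring
    have h2 : (1 - q) * (1 / (2 * Real.sqrt Real.pi) * G) ≤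
        Real.exp (-q) * (1 / (2 * Real.sqrt Real.pi) * G) := by
      have := Real.add_one_le_exp (-q)
      apply mul_le_mul_of_nonneg_right (by linarith) (by positivity)
    linarith

lemma hk_meas : Measurable (fun p : ℝ × ℝ => heatKer p.1 p.2) := by
  unfold heatKer
  apply Measurable.ite
  · exact measurableSet_lt measurable_const measurable_fst
  · fun_prop
  · exact measurable_const

/-- Lemma C.8 (lem:withgap): for `δ ∈ (0,1)`, `T > 1`, `h ≥ 0`, `δ ≤ t ≤ t + h ≤ T`
and `x ∈ ℝ`,
`√(πt)/2 − (T/(δ√π))√h − h (√π T^{3/2}/(8δ³)) x²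
  ≤ ∫₀ᵗ ∫_ℝ (ρ(t+h−r,x−z) ρ(r,z)/ρ(t+h,x)) (ρ(t−r,x−z) ρ(r,z)/ρ(t,x)) dz dr
  ≤ √(πt)/2`. -/
theorem stmt7 (δ T t h x : ℝ) (hδ0 : 0 < δ) (hδ1 : δ < 1) (hT : 1 < T)
    (hh : 0 ≤ h) (hδt : δ ≤ t) (htT : t + h ≤ T) :
    Real.sqrt (Real.pi * t) / 2 - T / (δ * Real.sqrt Real.pi) * Real.sqrt h -
        h * (Real.sqrt Real.pi * T ^ ((3:ℝ)/2) / (8 * δ ^ 3)) * x ^ 2 ≤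
      (∫ r in (0:ℝ)..t, ∫ z : ℝ,
        (heatKer (t + h - r) (x - z) * heatKer r z / heatKer (t + h) x) *
          (heatKer (t - r) (x - z) * heatKer r z / heatKer t x)) ∧
    (∫ r in (0:ℝ)..t, ∫ z : ℝ,
        (heatKer (t + h - r) (x - z) * heatKer r z / heatKer (t + h) x) *
          (heatKer (t - r) (x - z) * heatKer r z / heatKer t x)) ≤
      Real.sqrt (Real.pi * t) / 2 := by
  have hpi := Real.pi_pos
  have ht : 0 < t := by linarith
  have hth : 0 < t + h := by positivity
  set a := (1 / t + 1 / (t + h)) / 2 with ha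
  have ha0 : 0 < a := by positivity
  have hat' : a ≤ 1 / t := by
    have : 1 / (t + h) ≤ 1 / t := one_div_le_one_div_of_le ht (by linarith)
    linarith
  have hat : a * t ≤ 1 := by
    rwa [le_div_iff₀ ht] at hat'
  have h1t : 1 / t * t ≤ 1 := by field_simp; rfl
  have h1t0 : 0 < 1 / t := by positivity
  set F : ℝ → ℝ := fun r =>
    heatKer ((t + h - r) * r / (t + h) + (t - r) * r / t) (x * r / (t + h) - x * r / t) with hFd
  have hpw := fun r (hr : r ∈ Set.Ioo 0 t) => pointwise (x := x) ht hh hr.1 hr.2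
  have hI : (∫ r in (0:ℝ)..t, ∫ z : ℝ,
        (heatKer (t + h - r) (x - z) * heatKer r z / heatKer (t + h) x) *
          (heatKer (t - r) (x - z) * heatKer r z / heatKer t x)) = ∫ r in (0:ℝ)..t, F r := by
    rw [intervalIntegral.integral_of_le ht.le, intervalIntegral.integral_of_le ht.le,
      integral_Ioc_eq_integral_Ioo, integral_Ioc_eq_integral_Ioo]
    apply setIntegral_congr_fun measurableSet_Ioo
    intro r hr
    exact inner_eq_s7 hr.1 hr.2 (by linarith [hr.2])
  rw [hI]
  have hUi := (g_int h1t0 ht h1t).const_mul (1 / (2 * Real.sqrt Real.pi))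
  have hFm : Measurable F :=
    hk_meas.comp (f := fun r : ℝ => ((t + h - r) * r / (t + h) + (t - r) * r / t,
      x * r / (t + h) - x * r / t)) (by fun_prop)
  have hFi : IntervalIntegrable F volume 0 t := by
    rw [intervalIntegrable_iff_integrableOn_Ioo_of_le ht.le] at hUi ⊢
    refine hUi.mono' hFm.aestronglyMeasurable ?_
    filter_upwards [ae_restrict_mem measurableSet_Ioo] with r hr
    rw [Real.norm_eq_abs, abs_of_nonneg]
    · exact (hpw r hr).1
    · simp only [hFd]
      unfold heatKer
      split_ifs <;> positivity
  have hspi := Real.sqrt_pos.2 hpi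
  have hst := Real.sqrt_pos.2 ht
  have hpp : Real.sqrt Real.pi * Real.sqrt Real.pi = Real.pi := Real.mul_self_sqrt hpi.le
  have hUv : 1 / (2 * Real.sqrt Real.pi) * (Real.pi * Real.sqrt t) = Real.sqrt (Real.pi * t) / 2 := by
    rw [Real.sqrt_mul hpi.le]
    field_simp
    nlinarith
  constructor
  · have hL1 := (g_int ha0 ht hat).const_mul (1 / (2 * Real.sqrt Real.pi))
    have hL2 := (g2_int ht).const_mul (x ^ 2 * h / (4 * Real.sqrt Real.pi * t ^ 2 * (t + h)))
    have hm := intervalIntegral.integral_mono_on_of_le_Ioo ht.le (hL1.sub hL2) hFi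
      (fun r hr => (hpw r hr).2)
    refine le_trans ?_ hm
    rw [intervalIntegral.integral_sub hL1 hL2, intervalIntegral.integral_const_mul,
      intervalIntegral.integral_const_mul, g2_val ht, g_val ha0 ht hat]
    have e1 : 2 * a * t - 1 = t / (t + h) := by rw [ha]; field_simp; ring
    rw [e1]
    have hb := arcsin_bound ht hh
    have hasn : 0 ≤ Real.arcsin (t / (t + h)) := Real.arcsin_nonneg.2 (by positivity)
    have hsa : Real.sqrt t ≤ 1 / Real.sqrt a := by
      rw [le_div_iff₀ (Real.sqrt_pos.2 ha0), ← Real.sqrt_mul ht.le, Real.sqrt_le_iff]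
      exact ⟨by norm_num, by linarith⟩
    have hA : Real.sqrt (Real.pi * t) / 2 - T / (δ * Real.sqrt Real.pi) * Real.sqrt h ≤
        1 / (2 * Real.sqrt Real.pi) *
          ((Real.arcsin (t / (t + h)) + Real.pi / 2) / Real.sqrt a) := by
      calc _ ≤ Real.sqrt (Real.pi * t) / 2 - 1 / Real.sqrt Real.pi * Real.sqrt h := by
            gcongr
            · nlinarith
        _ = 1 / (2 * Real.sqrt Real.pi) * ((Real.pi - 2 * Real.sqrt (h / t)) * Real.sqrt t) := by
            rw [← hUv, Real.sqrt_div hh]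
            field_simp
        _ ≤ 1 / (2 * Real.sqrt Real.pi) *
              ((Real.arcsin (t / (t + h)) + Real.pi / 2) * Real.sqrt t) := by
            gcongr
            linarith
        _ ≤ _ := by
            rw [div_eq_mul_one_div _ (Real.sqrt a)]
            gcongr
    have hB : x ^ 2 * h / (4 * Real.sqrt Real.pi * t ^ 2 * (t + h)) *
        (t / 2 * (Real.pi * Real.sqrt t)) ≤
        h * (Real.sqrt Real.pi * T ^ ((3:ℝ)/2) / (8 * δ ^ 3)) * x ^ 2 := by
      have hT1 : 1 ≤ T ^ ((3:ℝ)/2) := Real.one_le_rpow hT.le (by norm_num)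
      have e : x ^ 2 * h / (4 * Real.sqrt Real.pi * t ^ 2 * (t + h)) *
        (t / 2 * (Real.pi * Real.sqrt t)) =
          h * (Real.sqrt Real.pi * 1 / (8 * (Real.sqrt t * (t + h)))) * x ^ 2 := by
        have := Real.mul_self_sqrt ht.le
        field_simp
        rw [Real.sq_sqrt ht.le, Real.sq_sqrt hpi.le]
        ring
      rw [e]
      have h3 : δ ^ 3 ≤ Real.sqrt t * (t + h) := by
        have : δ ≤ Real.sqrt t := Real.le_sqrt_of_sq_le (by nlinarith)
        have : δ * δ ≤ Real.sqrt t * (t + h) := by gcongr; linarith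
        nlinarith [mul_pos hδ0 hδ0]
      gcongr
    linarith
  · have := intervalIntegral.integral_mono_on_of_le_Ioo ht.le hFi hUi (fun r hr => (hpw r hr).1)
    rwa [intervalIntegral.integral_const_mul, g1_val ht, hUv] at this
end

section
/- Let h ∈ (0,1], α ∈ (0,1], t ∈ (0, h^α], and x ∈ ℝ. Then ∫₀ᵗ ∫_ℝ ( ρ(t+h−r, x−z)·ρ(r,z)/ρ(t+h, x) − ρ(t−r, x−z)·ρ(r,z)/ρ(t, x) )² dz dr ≤ 10·h^{α/2}. -/
open MeasureTheory

lemma bridge_sq (T r x z : ℝ) (hr : 0 < r) (hT : r < T) :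
    (heatKer (T - r) (x - z) * heatKer r z / heatKer T x) ^ 2 =
      (T / (r * (T - r))) / (2 * Real.pi) *
        Real.exp (-(T / (r * (T - r))) * (z - r * x / T) ^ 2) := by
  have hT0 : 0 < T := hr.trans hT
  have hs : 0 < T - r := sub_pos.2 hT
  have hpi := Real.pi_pos
  simp only [heatKer, hr, hT0, hs, if_true]
  have e1 : Real.exp (-(T / (r * (T - r))) * (z - r * x / T) ^ 2) =
      (Real.exp (-(x - z) ^ 2 / (2 * (T - r))) * Real.exp (-z ^ 2 / (2 * r)) /
        Real.exp (-x ^ 2 / (2 * T))) ^ 2 := by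
    rw [← Real.exp_add, ← Real.exp_sub, ← Real.exp_nat_mul]
    congr 1
    have h1 := hT0.ne'
    have h2 := hs.ne'
    have h3 := hr.ne'
    push_cast
    field_simp
    ring
  rw [e1]
  have s1 := Real.sq_sqrt (show 0 ≤ 2 * Real.pi * (T - r) by positivity)
  have s2 := Real.sq_sqrt (show 0 ≤ 2 * Real.pi * r by positivity)
  have s3 := Real.sq_sqrt (show 0 ≤ 2 * Real.pi * T by positivity)
  simp only [div_pow, mul_pow, s1, s2, s3]
  have h2 := hs.ne'
  field_simp

lemma bridge_int (T r x : ℝ) (hr : 0 < r) (hT : r < T) :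
    Integrable (fun z => (heatKer (T - r) (x - z) * heatKer r z / heatKer T x) ^ 2) ∧
    ∫ z : ℝ, (heatKer (T - r) (x - z) * heatKer r z / heatKer T x) ^ 2 ≤
      Real.sqrt (T / (r * (T - r))) / 2 := by
  have hT0 : 0 < T := hr.trans hT
  have hs : 0 < T - r := sub_pos.2 hT
  simp only [bridge_sq T r x _ hr hT]
  have hb : 0 < T / (r * (T - r)) := by positivity
  generalize T / (r * (T - r)) = b at hb
  constructor
  · exact ((integrable_exp_neg_mul_sq hb).comp_sub_right (r * x / T)).const_mul _
  · rw [integral_const_mul,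
      integral_sub_right_eq_self (fun z => Real.exp (-b * z ^ 2)) (r * x / T),
      integral_gaussian]
    have hpi := Real.pi_pos
    have hp3 := Real.pi_gt_three
    have hsp : 1 ≤ Real.sqrt Real.pi := Real.one_le_sqrt.2 (by linarith)
    have hsb : 0 < Real.sqrt b := Real.sqrt_pos.2 hb
    rw [Real.sqrt_div hpi.le]
    have a1 := Real.sq_sqrt hb.le
    have a2 := Real.sq_sqrt hpi.le
    have : b / (2 * Real.pi) * (Real.sqrt Real.pi / Real.sqrt b) =
        Real.sqrt b / 2 / Real.sqrt Real.pi := by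
      rw [div_mul_div_comm, div_div, div_eq_div_iff (by positivity) (by positivity)]
      calc b * √Real.pi * (2 * √Real.pi) = b * 2 * (√Real.pi) ^ 2 := by ring
        _ = (√b) ^ 2 * 2 * Real.pi := by rw [a1, a2]
        _ = _ := by ring
    rw [this]
    exact div_le_self (by positivity) hsp

lemma heatKer_nonneg (t x : ℝ) : 0 ≤ heatKer t x := by
  unfold heatKer
  split_ifs <;> positivity

lemma sqrt_bd (t T r : ℝ) (hr : 0 < r) (ht : r < t) (hT : t ≤ T) :
    Real.sqrt (T / (r * (T - r))) ≤ r ^ (-(1/2) : ℝ) + (t - r) ^ (-(1/2) : ℝ) := by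
  have hs : 0 < t - r := sub_pos.2 ht
  have hS : 0 < T - r := by linarith
  have sq : ∀ y : ℝ, 0 < y → (y ^ (-(1/2) : ℝ)) ^ 2 = 1 / y := by
    intro y hy
    rw [← Real.rpow_natCast, ← Real.rpow_mul hy.le]
    norm_num [Real.rpow_neg_one]
  have p1 : 0 < r ^ (-(1/2) : ℝ) := Real.rpow_pos_of_pos hr _
  have p2 : 0 < (t - r) ^ (-(1/2) : ℝ) := Real.rpow_pos_of_pos hs _
  apply Real.sqrt_le_iff.2 ⟨by positivity, ?_⟩
  have e : T / (r * (T - r)) = 1 / r + 1 / (T - r) := by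
    have := hS.ne'
    field_simp
    ring
  have l : 1 / (T - r) ≤ 1 / (t - r) := one_div_le_one_div_of_le hs (by linarith)
  rw [e]
  nlinarith [sq r hr, sq _ hs, mul_pos p1 p2]

lemma inner_bd (h t x r : ℝ) (hh0 : 0 < h) (hr : 0 < r) (ht : r < t) :
    (∫ z : ℝ, (heatKer (t + h - r) (x - z) * heatKer r z / heatKer (t + h) x -
          heatKer (t - r) (x - z) * heatKer r z / heatKer t x) ^ 2) ≤
      r ^ (-(1/2) : ℝ) + (t - r) ^ (-(1/2) : ℝ) := by
  obtain ⟨i1, b1⟩ := bridge_int (t + h) r x hr (by linarith)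
  obtain ⟨i2, b2⟩ := bridge_int t r x hr ht
  have s1 := sqrt_bd t (t + h) r hr ht (by linarith)
  have s2 := sqrt_bd t t r hr ht le_rfl
  refine (integral_mono_of_nonneg (Filter.Eventually.of_forall fun z => sq_nonneg _)
    (i1.add i2) (Filter.Eventually.of_forall fun z => ?_)).trans ?_
  · have n1 : 0 ≤ heatKer (t + h - r) (x - z) * heatKer r z / heatKer (t + h) x :=
      div_nonneg (mul_nonneg (heatKer_nonneg _ _) (heatKer_nonneg _ _)) (heatKer_nonneg _ _)
    have n2 : 0 ≤ heatKer (t - r) (x - z) * heatKer r z / heatKer t x :=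
      div_nonneg (mul_nonneg (heatKer_nonneg _ _) (heatKer_nonneg _ _)) (heatKer_nonneg _ _)
    simp only [Pi.add_apply]
    nlinarith [mul_nonneg n1 n2]
  · simp only [Pi.add_apply]
    rw [integral_add i1 i2]
    linarith

/-- Lemma C.9 (lem:near0): for `h ∈ (0,1]`, `α ∈ (0,1]`, `t ∈ (0, h^α]`, `x ∈ ℝ`,
`∫₀ᵗ ∫_ℝ (ρ(t+h−r,x−z) ρ(r,z)/ρ(t+h,x) − ρ(t−r,x−z) ρ(r,z)/ρ(t,x))² dz dr
  ≤ 10 h^{α/2}`. -/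
theorem stmt8 (h α t x : ℝ) (hh0 : 0 < h) (hh1 : h ≤ 1) (hα0 : 0 < α) (hα1 : α ≤ 1)
    (ht0 : 0 < t) (ht : t ≤ h ^ α) :
    (∫ r in (0:ℝ)..t, ∫ z : ℝ,
        (heatKer (t + h - r) (x - z) * heatKer r z / heatKer (t + h) x -
          heatKer (t - r) (x - z) * heatKer r z / heatKer t x) ^ 2) ≤
      10 * h ^ (α / 2) := by
  have j1 : IntervalIntegrable (fun r : ℝ => r ^ (-(1/2) : ℝ)) volume 0 t :=
    intervalIntegral.intervalIntegrable_rpow' (by norm_num)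
  have j2 : IntervalIntegrable (fun r : ℝ => (t - r) ^ (-(1/2) : ℝ)) volume 0 t := by
    have := (j1.comp_sub_left t).symm
    simpa using this
  have v1 : ∫ r in (0:ℝ)..t, r ^ (-(1/2) : ℝ) = 2 * t ^ (1/2 : ℝ) := by
    rw [integral_rpow (Or.inl (by norm_num))]
    norm_num
    ring
  have v2 : ∫ r in (0:ℝ)..t, (t - r) ^ (-(1/2) : ℝ) = 2 * t ^ (1/2 : ℝ) := by
    rw [intervalIntegral.integral_comp_sub_left (fun r : ℝ => r ^ (-(1/2) : ℝ)) t]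
    simpa using v1
  have key : t ^ (1/2 : ℝ) ≤ h ^ (α / 2) := by
    calc t ^ (1/2 : ℝ) ≤ (h ^ α) ^ (1/2 : ℝ) :=
          Real.rpow_le_rpow ht0.le ht (by norm_num)
      _ = h ^ (α / 2) := by
          rw [← Real.rpow_mul hh0.le]
          congr 1
          ring
  have hp : 0 < h ^ (α / 2) := Real.rpow_pos_of_pos hh0 _
  have main : (∫ r in (0:ℝ)..t, ∫ z : ℝ,
        (heatKer (t + h - r) (x - z) * heatKer r z / heatKer (t + h) x -
          heatKer (t - r) (x - z) * heatKer r z / heatKer t x) ^ 2) ≤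
      ∫ r in (0:ℝ)..t, (r ^ (-(1/2) : ℝ) + (t - r) ^ (-(1/2) : ℝ)) := by
    have j3 := (j1.add j2).1
    rw [intervalIntegral.integral_of_le ht0.le, intervalIntegral.integral_of_le ht0.le]
    rw [integral_Ioc_eq_integral_Ioo, integral_Ioc_eq_integral_Ioo]
    refine integral_mono_of_nonneg
      (Filter.Eventually.of_forall fun r => integral_nonneg fun z => sq_nonneg _)
      (j3.mono_set Set.Ioo_subset_Ioc_self) ?_
    filter_upwards [ae_restrict_mem measurableSet_Ioo] with r hr
    exact inner_bd h t x r hh0 hr.1 hr.2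
  rw [intervalIntegral.integral_add j1 j2, v1, v2] at main
  linarith
end

section
/- Let (S, 𝒮) be a measurable space, let Q : ℝ × ℝ → ProbabilityMeasures(S) be such that (y,x) ↦ Q_{y,x}(A) is Borel measurable for every A ∈ 𝒮, and let Z : ℝ × ℝ → (0, ∞) be Borel measurable. For finite positive Borel measures μ, ζ on ℝ write Z(ζ|μ) = ∫_ℝ ∫_ℝ Z(y,x) ζ(dx) μ(dy), and whenever 0 < Z(ζ|μ) < ∞ define the probability measure Q_{μ,ζ} on (S,𝒮) by Q_{μ,ζ}(A) = Z(ζ|μ)^{-1} ∫_ℝ ∫_ℝ Z(y,x) Q_{y,x}(A) ζ(dx) μ(dy). Let μ₁, μ₂, ζ₁, ζ₂ be finite positive Borel measures on ℝ such that Z(ζ₁|μ₁), Z(ζ₂|μ₁), Z(ζ₂|μ₂) ∈ (0, ∞) and Z(|ζ₂−ζ₁| | μ₁), Z(ζ₂ | |μ₂−μ₁|) < ∞. Then for every A ∈ 𝒮, |Q_{μ₁,ζ₁}(A) − Q_{μ₂,ζ₂}(A)| ≤ Z(|ζ₂−ζ₁| | μ₁)/Z(ζ₁|μ₁) + Z(ζ₂|μ₁)·|Z(ζ₁|μ₁)^{-1}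 − Z(ζ₂|μ₁)^{-1}| + Z(ζ₂ | |μ₂−μ₁|)/Z(ζ₂|μ₁) + Z(ζ₂|μ₂)·|Z(ζ₂|μ₁)^{-1} − Z(ζ₂|μ₂)^{-1}|; consequently one half of the total variation norm ‖Q_{μ₁,ζ₁} − Q_{μ₂,ζ₂}‖_TV is bounded by the same right-hand side. -/
open MeasureTheory

/-- `Zint Z μ ζ = ∫_ℝ ∫_ℝ Z(y,x) ζ(dx) μ(dy)`, as a Lebesgue integral in `[0,∞]`. -/
noncomputable def Zint (Z : ℝ → ℝ → ℝ) (μ ζ : Measure ℝ) : ENNReal :=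
  ∫⁻ y, ∫⁻ x, ENNReal.ofReal (Z y x) ∂ζ ∂μ

/-- The mixture probability
`Q_{μ,ζ}(A) = Z(ζ|μ)^{-1} ∫_ℝ ∫_ℝ Z(y,x) Q_{y,x}(A) ζ(dx) μ(dy)`. -/
noncomputable def Qmix {S : Type*} [MeasurableSpace S] (Q : ℝ → ℝ → Measure S)
    (Z : ℝ → ℝ → ℝ) (μ ζ : Measure ℝ) (A : Set S) : ℝ :=
  (∫⁻ y, ∫⁻ x, ENNReal.ofReal (Z y x) * Q y x A ∂ζ ∂μ).toReal / (Zint Z μ ζ).toReal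

lemma aux_le (a b : Measure ℝ) [IsFiniteMeasure a] [IsFiniteMeasure b] :
    a ≤ b + (a.toSignedMeasure - b.toSignedMeasure).totalVariation ∧
    b ≤ a + (a.toSignedMeasure - b.toSignedMeasure).totalVariation := by
  set s := a.toSignedMeasure - b.toSignedMeasure with hs
  set j := s.toJordanDecomposition with hj
  have h1 : j.posPart.toSignedMeasure - j.negPart.toSignedMeasure = s :=
    s.toSignedMeasure_toJordanDecomposition
  have h2 : a + j.negPart = b + j.posPart := by
    rw [← Measure.toSignedMeasure_eq_toSignedMeasure_iff, Measure.toSignedMeasure_add,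
      Measure.toSignedMeasure_add]
    have h3 : j.posPart.toSignedMeasure - j.negPart.toSignedMeasure
        = a.toSignedMeasure - b.toSignedMeasure := h1
    have h4 := sub_eq_sub_iff_add_eq_add.mp h3
    rw [← h4, add_comm]
  have htv : s.totalVariation = j.posPart + j.negPart := rfl
  rw [htv]
  constructor
  · calc a ≤ a + j.negPart := Measure.le_add_right le_rfl
      _ = b + j.posPart := h2
      _ ≤ _ := by
        rw [← add_assoc]
        exact Measure.le_add_right le_rfl
  · calc b ≤ b + j.posPart := Measure.le_add_right le_rfl
      _ = a + j.negPart := h2.symm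
      _ ≤ _ := by
        rw [add_comm j.posPart, ← add_assoc]
        exact Measure.le_add_right le_rfl

lemma aux_real (n m d z w : ℝ) (hz : 0 < z) (hw : 0 < w) (hm : 0 ≤ m) (hmw : m ≤ w)
    (h1 : n ≤ m + d) (h2 : m ≤ n + d) :
    |n / z - m / w| ≤ d / z + w * |z⁻¹ - w⁻¹| := by
  have e : n / z - m / w = (n - m) / z + m * (z⁻¹ - w⁻¹) := by
    field_simp
    ring
  rw [e]
  refine (abs_add_le _ _).trans ?_
  rw [abs_div, abs_mul, abs_of_pos hz, abs_of_nonneg hm]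
  have : |n - m| ≤ d := abs_le.mpr ⟨by linarith, by linarith⟩
  gcongr

lemma aux_toReal {a b c d : ENNReal} (hb : b < ⊤) (hc : c < ⊤) (hcd : d ≤ c) (h : a ≤ b + d) :
    a.toReal ≤ b.toReal + c.toReal := by
  rw [← ENNReal.toReal_add hb.ne hc.ne]
  exact ENNReal.toReal_mono (by simp [hb.ne, hc.ne]) (h.trans (by gcongr))

/-- Theorem 2.6(v) (abstract form): total variation comparison of measure-to-measure
polymer distributions.  `|ν|` is formalized as the total variation measure of the
corresponding signed measure. -/
theorem stmt11 {S : Type*} [MeasurableSpace S]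
    (Q : ℝ → ℝ → Measure S) (hQprob : ∀ y x : ℝ, IsProbabilityMeasure (Q y x))
    (hQmeas : ∀ A : Set S, MeasurableSet A → Measurable fun p : ℝ × ℝ => Q p.1 p.2 A)
    (Z : ℝ → ℝ → ℝ) (hZmeas : Measurable fun p : ℝ × ℝ => Z p.1 p.2)
    (hZpos : ∀ y x : ℝ, 0 < Z y x)
    (μ₁ μ₂ ζ₁ ζ₂ : Measure ℝ)
    [IsFiniteMeasure μ₁] [IsFiniteMeasure μ₂] [IsFiniteMeasure ζ₁] [IsFiniteMeasure ζ₂]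
    (h11pos : 0 < Zint Z μ₁ ζ₁) (h11fin : Zint Z μ₁ ζ₁ < ⊤)
    (h12pos : 0 < Zint Z μ₁ ζ₂) (h12fin : Zint Z μ₁ ζ₂ < ⊤)
    (h22pos : 0 < Zint Z μ₂ ζ₂) (h22fin : Zint Z μ₂ ζ₂ < ⊤)
    (hdζ : Zint Z μ₁ ((ζ₂.toSignedMeasure - ζ₁.toSignedMeasure).totalVariation) < ⊤)
    (hdμ : Zint Z ((μ₂.toSignedMeasure - μ₁.toSignedMeasure).totalVariation) ζ₂ < ⊤) :
    ∀ A : Set S, MeasurableSet A →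
      |Qmix Q Z μ₁ ζ₁ A - Qmix Q Z μ₂ ζ₂ A| ≤
        (Zint Z μ₁ ((ζ₂.toSignedMeasure - ζ₁.toSignedMeasure).totalVariation)).toReal /
            (Zint Z μ₁ ζ₁).toReal +
          (Zint Z μ₁ ζ₂).toReal *
            |(Zint Z μ₁ ζ₁).toReal⁻¹ - (Zint Z μ₁ ζ₂).toReal⁻¹| +
          (Zint Z ((μ₂.toSignedMeasure - μ₁.toSignedMeasure).totalVariation) ζ₂).toReal /
            (Zint Z μ₁ ζ₂).toReal +
          (Zint Z μ₂ ζ₂).toReal *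
            |(Zint Z μ₁ ζ₂).toReal⁻¹ - (Zint Z μ₂ ζ₂).toReal⁻¹| := by
  intro A hA
  set N : Measure ℝ → Measure ℝ → ENNReal := fun μ ζ =>
    ∫⁻ y, ∫⁻ x, ENNReal.ofReal (Z y x) * Q y x A ∂ζ ∂μ with hN
  have hNZ : ∀ μ ζ, N μ ζ ≤ Zint Z μ ζ := by
    intro μ ζ
    refine lintegral_mono fun y => lintegral_mono fun x => ?_
    have := hQprob y x
    exact mul_le_of_le_one_right' prob_le_one
  have hf : Measurable fun p : ℝ × ℝ => ENNReal.ofReal (Z p.1 p.2) * Q p.1 p.2 A :=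
    hZmeas.ennreal_ofReal.mul (hQmeas A hA)
  have hζ : ∀ (μ a b t : Measure ℝ) [SFinite b], a ≤ b + t → N μ a ≤ N μ b + N μ t := by
    intro μ a b t _ h
    have hm : Measurable fun y => ∫⁻ x, ENNReal.ofReal (Z y x) * Q y x A ∂b :=
      hf.lintegral_prod_right'
    simp only [hN]
    rw [← lintegral_add_left hm]
    refine lintegral_mono fun y => ?_
    rw [← lintegral_add_measure]
    exact lintegral_mono' h le_rfl
  have hμ : ∀ (ζ a b t : Measure ℝ), a ≤ b + t → N a ζ ≤ N b ζ + N t ζ := by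
    intro ζ a b t h
    simp only [hN]
    rw [← lintegral_add_measure]
    exact lintegral_mono' h le_rfl
  have f11 := (hNZ μ₁ ζ₁).trans_lt h11fin
  have f12 := (hNZ μ₁ ζ₂).trans_lt h12fin
  have f22 := (hNZ μ₂ ζ₂).trans_lt h22fin
  have p11 := ENNReal.toReal_pos h11pos.ne' h11fin.ne
  have p12 := ENNReal.toReal_pos h12pos.ne' h12fin.ne
  have p22 := ENNReal.toReal_pos h22pos.ne' h22fin.ne
  obtain ⟨z1, z2⟩ := aux_le ζ₂ ζ₁
  obtain ⟨m1, m2⟩ := aux_le μ₂ μ₁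
  have A1 := aux_real (N μ₁ ζ₁).toReal (N μ₁ ζ₂).toReal _ _ _ p11 p12 ENNReal.toReal_nonneg
    (ENNReal.toReal_mono h12fin.ne (hNZ _ _))
    (aux_toReal f12 hdζ (hNZ _ _) (hζ _ _ _ _ z2))
    (aux_toReal f11 hdζ (hNZ _ _) (hζ _ _ _ _ z1))
  have A2 := aux_real (N μ₁ ζ₂).toReal (N μ₂ ζ₂).toReal _ _ _ p12 p22 ENNReal.toReal_nonneg
    (ENNReal.toReal_mono h22fin.ne (hNZ _ _))
    (aux_toReal f22 hdμ (hNZ _ _) (hμ _ _ _ _ m2))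
    (aux_toReal f12 hdμ (hNZ _ _) (hμ _ _ _ _ m1))
  have A3 := abs_sub_le (Qmix Q Z μ₁ ζ₁ A) (Qmix Q Z μ₁ ζ₂ A) (Qmix Q Z μ₂ ζ₂ A)
  have A1' : |Qmix Q Z μ₁ ζ₁ A - Qmix Q Z μ₁ ζ₂ A| ≤ _ := A1
  have A2' : |Qmix Q Z μ₁ ζ₂ A - Qmix Q Z μ₂ ζ₂ A| ≤ _ := A2
  linarith
end

section
/- Let τ > 0, let C > 0, and let w : ℝ × ℝ → ℝ be Borel measurable with 0 ≤ w(x,y) ≤ C·(1 + x⁴ + y⁴) for all x, y ∈ ℝ. Let μ be a positive Borel measure on ℝ such that ∫_ℝ e^{−a y²} μ(dy) < ∞ for every a > 0. Then for every a > 0: ∫_ℝ e^{−a x²}·( ∫_ℝ ρ(τ, x−y)·w(x,y) μ(dy) ) dx < ∞. -/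
open MeasureTheory

theorem stmt13_bound (τ : ℝ) (hτ : 0 < τ) (C : ℝ) (hC : 0 < C)
    (w : ℝ → ℝ → ℝ)
    (hwu : ∀ x y : ℝ, w x y ≤ C * (1 + x ^ 4 + y ^ 4)) (a : ℝ) (ha : 0 < a) :
    ∃ K b : ℝ, 0 < K ∧ 0 < b ∧ ∀ x y : ℝ,
      Real.exp (-a * x ^ 2) * (heatKer τ (x - y) * w x y) ≤
        (K * Real.exp (-b * x ^ 2)) * Real.exp (-b * y ^ 2) := by
  obtain ⟨s, hs⟩ : ∃ s : ℝ, s = 1 / (2 * τ) := ⟨_, rfl⟩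
  have hs0 : 0 < s := by rw [hs]; positivity
  obtain ⟨b, hb, hb1, hb2⟩ : ∃ b : ℝ, 0 < b ∧ 8 * b ≤ a ∧ 4 * b ≤ s := by
    refine ⟨min (a / 8) (s / 4), by positivity, ?_, ?_⟩
    · linarith [min_le_left (a / 8) (s / 4)]
    · linarith [min_le_right (a / 8) (s / 4)]
  have hS : 0 < Real.sqrt (2 * Real.pi * τ) := Real.sqrt_pos.2 (by positivity)
  refine ⟨C * (1 + 2 / b ^ 2) / Real.sqrt (2 * Real.pi * τ), b, by positivity, hb, ?_⟩
  intro x y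
  have hpoly : 1 + x ^ 4 + y ^ 4 ≤ (1 + 2 / b ^ 2) * Real.exp (b * (x ^ 2 + y ^ 2)) := by
    have hr : 0 ≤ x ^ 2 + y ^ 2 := by positivity
    have h1 := Real.quadratic_le_exp_of_nonneg (x := b * (x ^ 2 + y ^ 2)) (by positivity)
    have h2 : 0 ≤ b * (x ^ 2 + y ^ 2) := by positivity
    have h3 : 1 ≤ Real.exp (b * (x ^ 2 + y ^ 2)) := Real.one_le_exp h2
    have h4 : (x ^ 2 + y ^ 2) ^ 2 ≤ 2 / b ^ 2 * Real.exp (b * (x ^ 2 + y ^ 2)) := by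
      have : (b * (x ^ 2 + y ^ 2)) ^ 2 / 2 ≤ Real.exp (b * (x ^ 2 + y ^ 2)) := by linarith
      calc (x ^ 2 + y ^ 2) ^ 2 = 2 / b ^ 2 * ((b * (x ^ 2 + y ^ 2)) ^ 2 / 2) := by
            field_simp
        _ ≤ _ := by gcongr
    have h5 : 0 ≤ x ^ 2 * y ^ 2 := by positivity
    nlinarith
  have hexp : -a * x ^ 2 + (-(x - y) ^ 2 / (2 * τ)) + b * (x ^ 2 + y ^ 2)
      ≤ -b * x ^ 2 + -b * y ^ 2 := by
    have e : -(x - y) ^ 2 / (2 * τ) = - (s * (x - y) ^ 2) := by rw [hs]; ring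
    rw [e]
    have h1 := mul_le_mul_of_nonneg_right hb1 (sq_nonneg x)
    have h2 := mul_le_mul_of_nonneg_right hb2 (sq_nonneg (x - y))
    have h3 : 0 ≤ b * (2 * x - y) ^ 2 := by positivity
    have h4 : 0 ≤ b * x ^ 2 := by positivity
    have h5 : 0 ≤ b * (x - y) ^ 2 := by positivity
    nlinarith
  have hh : heatKer τ (x - y)
      = Real.exp (-(x - y) ^ 2 / (2 * τ)) / Real.sqrt (2 * Real.pi * τ) := by
    simp [heatKer, hτ]
  rw [hh]
  calc Real.exp (-a * x ^ 2) *
        (Real.exp (-(x - y) ^ 2 / (2 * τ)) / Real.sqrt (2 * Real.pi * τ) * w x y)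
      ≤ Real.exp (-a * x ^ 2) *
        (Real.exp (-(x - y) ^ 2 / (2 * τ)) / Real.sqrt (2 * Real.pi * τ) *
          (C * ((1 + 2 / b ^ 2) * Real.exp (b * (x ^ 2 + y ^ 2))))) := by
        have : w x y ≤ C * ((1 + 2 / b ^ 2) * Real.exp (b * (x ^ 2 + y ^ 2))) :=
          (hwu x y).trans (mul_le_mul_of_nonneg_left hpoly hC.le)
        gcongr
    _ = C * (1 + 2 / b ^ 2) / Real.sqrt (2 * Real.pi * τ) *
        Real.exp (-a * x ^ 2 + (-(x - y) ^ 2 / (2 * τ)) + b * (x ^ 2 + y ^ 2)) := by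
        rw [Real.exp_add, Real.exp_add]; ring
    _ ≤ C * (1 + 2 / b ^ 2) / Real.sqrt (2 * Real.pi * τ) *
        Real.exp (-b * x ^ 2 + -b * y ^ 2) := by gcongr
    _ = _ := by rw [Real.exp_add]; ring

/-- Deterministic core of Theorem 2.3(ii): preservation of the class `M_G` of
measures with all Gaussian moments finite, for a weight `w` with a quartic
polynomial upper bound. -/
theorem stmt13 (τ : ℝ) (hτ : 0 < τ) (C : ℝ) (hC : 0 < C)
    (w : ℝ → ℝ → ℝ) (hw0 : ∀ x y : ℝ, 0 ≤ w x y)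
    (hwu : ∀ x y : ℝ, w x y ≤ C * (1 + x ^ 4 + y ^ 4))
    (μ : Measure ℝ)
    (hμ : ∀ a : ℝ, 0 < a → (∫⁻ y, ENNReal.ofReal (Real.exp (-a * y ^ 2)) ∂μ) < ⊤) :
    ∀ a : ℝ, 0 < a →
      (∫⁻ x : ℝ, ENNReal.ofReal (Real.exp (-a * x ^ 2)) *
        (∫⁻ y, ENNReal.ofReal (heatKer τ (x - y) * w x y) ∂μ)) < ⊤ := by
  intro a ha
  obtain ⟨K, b, hK, hb, hbound⟩ := stmt13_bound τ hτ C hC w hwu a ha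
  have hint : Integrable (fun x : ℝ => K * Real.exp (-b * x ^ 2)) :=
    (integrable_exp_neg_mul_sq hb).const_mul K
  have hfin : (∫⁻ x : ℝ, ENNReal.ofReal (K * Real.exp (-b * x ^ 2))) < ⊤ :=
    hint.lintegral_lt_top
  calc (∫⁻ x : ℝ, ENNReal.ofReal (Real.exp (-a * x ^ 2)) *
        (∫⁻ y, ENNReal.ofReal (heatKer τ (x - y) * w x y) ∂μ))
      ≤ ∫⁻ x : ℝ, ENNReal.ofReal (K * Real.exp (-b * x ^ 2)) *
        (∫⁻ y, ENNReal.ofReal (Real.exp (-b * y ^ 2)) ∂μ) := by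
        refine lintegral_mono fun x => ?_
        rw [← lintegral_const_mul' _ _ ENNReal.ofReal_ne_top,
          ← lintegral_const_mul' _ _ ENNReal.ofReal_ne_top]
        refine lintegral_mono fun y => ?_
        rw [← ENNReal.ofReal_mul (by positivity), ← ENNReal.ofReal_mul (by positivity)]
        exact ENNReal.ofReal_le_ofReal (hbound x y)
    _ = (∫⁻ x : ℝ, ENNReal.ofReal (K * Real.exp (-b * x ^ 2))) *
        (∫⁻ y, ENNReal.ofReal (Real.exp (-b * y ^ 2)) ∂μ) :=
        lintegral_mul_const' _ _ (hμ b hb).ne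
    _ < ⊤ := ENNReal.mul_lt_top hfin (hμ b hb)
end

section
/- Let τ > 0, let c > 0, and let w : ℝ × ℝ → ℝ be Borel measurable with w(x,y) ≥ c·(1 + x⁴ + y⁴)^{-1} for all x, y ∈ ℝ. Let ζ be a nonzero positive Borel measure on ℝ and let μ be a positive Borel measure on ℝ for which there exists a > 1/(2τ) with ∫_ℝ e^{−a y²} μ(dy) = ∞. Then ∫_ℝ ∫_ℝ ρ(τ, x−y)·w(x,y) μ(dy) ζ(dx) = ∞. -/
open MeasureTheory

lemma aux_bound (b δ x y : ℝ) (hδ : 0 < δ) :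
    Real.exp (-(b * x ^ 2 + 2 * b ^ 2 * x ^ 2 / δ)) * (1 + x ^ 4 + y ^ 4)
        * Real.exp (-(b + δ) * y ^ 2) ≤
      (1 + x ^ 4 + 8 / δ ^ 2) * Real.exp (-(b * (x - y) ^ 2)) := by
  set s : ℝ := δ / 2 * y ^ 2 with hs
  have hs0 : 0 ≤ s := by positivity
  have h1 := Real.quadratic_le_exp_of_nonneg hs0
  have h2 : 1 + x ^ 4 + y ^ 4 ≤ (1 + x ^ 4 + 8 / δ ^ 2) * Real.exp s := by
    have hy : y ^ 4 = 8 / δ ^ 2 * (s ^ 2 / 2) := by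
      rw [hs]; field_simp; norm_num
    have e1 : 8 / δ ^ 2 * (s ^ 2 / 2) ≤ 8 / δ ^ 2 * Real.exp s := by
      apply mul_le_mul_of_nonneg_left _ (by positivity)
      linarith
    have e2 : (1 + x ^ 4) * 1 ≤ (1 + x ^ 4) * Real.exp s := by
      apply mul_le_mul_of_nonneg_left _ (by positivity)
      nlinarith [sq_nonneg s]
    rw [hy]; linarith
  have h3 : -(b * x ^ 2 + 2 * b ^ 2 * x ^ 2 / δ) + s + -(b + δ) * y ^ 2
      ≤ -(b * (x - y) ^ 2) := by
    have : 0 ≤ δ / 2 * (y + 2 * b * x / δ) ^ 2 := by positivity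
    have e : δ / 2 * (y + 2 * b * x / δ) ^ 2
        = δ / 2 * y ^ 2 + 2 * b * x * y + 2 * b ^ 2 * x ^ 2 / δ := by
      field_simp; ring
    rw [hs]; nlinarith
  calc _ ≤ Real.exp (-(b * x ^ 2 + 2 * b ^ 2 * x ^ 2 / δ)) *
        ((1 + x ^ 4 + 8 / δ ^ 2) * Real.exp s) * Real.exp (-(b + δ) * y ^ 2) := by gcongr
    _ = (1 + x ^ 4 + 8 / δ ^ 2) *
        Real.exp (-(b * x ^ 2 + 2 * b ^ 2 * x ^ 2 / δ) + s + -(b + δ) * y ^ 2) := by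
      rw [Real.exp_add, Real.exp_add]; ring
    _ ≤ _ := by gcongr

/-- Deterministic core of Theorem 2.3(iii): explosion for initial measures outside
the class `M_G`: if some Gaussian moment of `μ` of parameter `a > 1/(2τ)` is infinite
and `ζ` is a nonzero positive measure, then the superposition integral is infinite. -/
theorem stmt14 (τ : ℝ) (hτ : 0 < τ) (c : ℝ) (hc : 0 < c)
    (w : ℝ → ℝ → ℝ)
    (hwl : ∀ x y : ℝ, c * (1 + x ^ 4 + y ^ 4)⁻¹ ≤ w x y)
    (ζ μ : Measure ℝ) (hζ : ζ ≠ 0)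
    (a : ℝ) (ha : 1 / (2 * τ) < a)
    (hμ : (∫⁻ y, ENNReal.ofReal (Real.exp (-a * y ^ 2)) ∂μ) = ⊤) :
    (∫⁻ x, ∫⁻ y, ENNReal.ofReal (heatKer τ (x - y) * w x y) ∂μ ∂ζ) = ⊤ := by
  have key : ∀ x, (∫⁻ y, ENNReal.ofReal (heatKer τ (x - y) * w x y) ∂μ) = ⊤ := by
    intro x
    set b : ℝ := 1 / (2 * τ) with hb
    obtain ⟨δ, hδ⟩ : ∃ δ, δ = a - b := ⟨_, rfl⟩
    have hδ0 : 0 < δ := by linarith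
    have hab : a = b + δ := by linarith
    obtain ⟨M, hM⟩ : ∃ M, M = 1 + x ^ 4 + 8 / δ ^ 2 := ⟨_, rfl⟩
    have hM0 : 0 < M := by rw [hM]; positivity
    obtain ⟨E, hE⟩ : ∃ E, E = Real.exp (-(b * x ^ 2 + 2 * b ^ 2 * x ^ 2 / δ)) := ⟨_, rfl⟩
    have hE0 : 0 < E := by rw [hE]; positivity
    obtain ⟨S, hS⟩ : ∃ S, S = Real.sqrt (2 * Real.pi * τ) := ⟨_, rfl⟩
    have hS0 : 0 < S := by rw [hS]; positivity
    have hK0 : 0 < c * E / (M * S) := by positivity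
    have hle : ∀ y, c * E / (M * S) * Real.exp (-a * y ^ 2) ≤ heatKer τ (x - y) * w x y := by
      intro y
      have hB := aux_bound b δ x y hδ0
      rw [← hab, ← hM, ← hE] at hB
      have hk : heatKer τ (x - y) = Real.exp (-(b * (x - y) ^ 2)) / S := by
        rw [heatKer, if_pos hτ, hS]
        congr 2
        rw [hb]; ring
      have hP : 0 < 1 + x ^ 4 + y ^ 4 := by positivity
      calc _ ≤ heatKer τ (x - y) * (c * (1 + x ^ 4 + y ^ 4)⁻¹) := by
            rw [hk]
            have : c * E / (M * S) * Real.exp (-a * y ^ 2)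
                = (c / (M * S * (1 + x ^ 4 + y ^ 4))) *
                  (E * (1 + x ^ 4 + y ^ 4) * Real.exp (-a * y ^ 2)) := by
              field_simp
            rw [this]
            refine (mul_le_mul_of_nonneg_left hB (by positivity)).trans (le_of_eq ?_)
            field_simp
        _ ≤ _ := by
            apply mul_le_mul_of_nonneg_left (hwl x y)
            rw [hk]; positivity
    rw [eq_top_iff]
    calc (⊤ : ENNReal) = ENNReal.ofReal (c * E / (M * S)) *
          ∫⁻ y, ENNReal.ofReal (Real.exp (-a * y ^ 2)) ∂μ := by
          rw [hμ, ENNReal.mul_top]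
          simpa using hK0
      _ = ∫⁻ y, ENNReal.ofReal (c * E / (M * S)) *
          ENNReal.ofReal (Real.exp (-a * y ^ 2)) ∂μ := by
          rw [lintegral_const_mul]
          fun_prop
      _ ≤ _ := by
          apply lintegral_mono
          intro y
          simp only
          rw [← ENNReal.ofReal_mul hK0.le]
          exact ENNReal.ofReal_le_ofReal (hle y)
  simp_rw [key]
  rw [lintegral_const, ENNReal.top_mul]
  simpa using hζ
end

section
/- Let τ > 0, let C ≥ 1, and let w : ℝ × ℝ → ℝ be Borel measurable with C^{-1}·(1 + x⁴ + z⁴)^{-1} ≤ w(x,z) ≤ C·(1 + x⁴ + z⁴) for all x, z ∈ ℝ. Let λ₊, λ₋ ∈ ℝ and let f : ℝ → ℝ be Borel measurable, bounded on every compact set, and such that f(z)/z → λ₊ as z → +∞ and f(z)/z → λ₋ as z → −∞. Define g(x) = ∫_ℝ ρ(τ, x−z)·w(x,z)·e^{f(z)} dz. Then g(x) ∈ (0, ∞) for every x ∈ ℝ, and (log g(x))/x → λ₊ as x → +∞ and (log g(x))/x → λ₋ as x → −∞. -/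
open MeasureTheory Filter

/-- The integral `g(x) = ∫_ℝ ρ(τ, x−z) w(x,z) e^{f(z)} dz`, as a Lebesgue
integral with values in `[0,∞]`. -/
noncomputable def gKPZ (τ : ℝ) (w : ℝ → ℝ → ℝ) (f : ℝ → ℝ) (x : ℝ) : ENNReal :=
  ∫⁻ z : ℝ, ENNReal.ofReal (heatKer τ (x - z) * w x z * Real.exp (f z))

lemma kpz_lin (f : ℝ → ℝ) (lam : ℝ)
    (hfloc : ∀ K : Set ℝ, IsCompact K → ∃ M : ℝ, ∀ z ∈ K, |f z| ≤ M)
    (hf : Tendsto (fun z => f z / z) atTop (nhds lam)) (ε : ℝ) (hε : 0 < ε) :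
    ∃ A : ℝ, 0 ≤ A ∧ ∀ z : ℝ, 0 ≤ z → |f z - lam * z| ≤ A + ε * z := by
  have h := (Metric.tendsto_nhds.1 hf) ε hε
  obtain ⟨N, hN⟩ := eventually_atTop.1 h
  obtain ⟨M, hM⟩ := hfloc (Set.Icc 0 (max N 1)) isCompact_Icc
  have hm1 : 1 ≤ max N 1 := le_max_right _ _
  refine ⟨|M| + |lam| * max N 1, by positivity, fun z hz => ?_⟩
  rcases le_total z (max N 1) with h1 | h1
  · have h2 := hM z ⟨hz, h1⟩
    have h3 : |f z - lam * z| ≤ |f z| + |lam| * z := by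
      have := abs_sub (f z) (lam * z)
      rwa [abs_mul, abs_of_nonneg hz] at this
    have h4 : |lam| * z ≤ |lam| * max N 1 := by gcongr
    have h5 := le_abs_self M
    have h6 : 0 ≤ ε * z := by positivity
    linarith
  · have hz0 : 0 < z := by linarith
    have h2 := hN z ((le_max_left _ _).trans h1)
    rw [Real.dist_eq] at h2
    have h3 : f z - lam * z = (f z / z - lam) * z := by field_simp
    have h4 : |f z - lam * z| ≤ ε * z := by
      rw [h3, abs_mul, abs_of_pos hz0]; gcongr
    have h5 : 0 ≤ |M| + |lam| * max N 1 := by positivity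
    linarith

lemma kpz_f (f : ℝ → ℝ) (lamP lamM : ℝ)
    (hfloc : ∀ K : Set ℝ, IsCompact K → ∃ M : ℝ, ∀ z ∈ K, |f z| ≤ M)
    (hfloc' : ∀ K : Set ℝ, IsCompact K → ∃ M : ℝ, ∀ z ∈ K, |f (-z)| ≤ M)
    (hfP : Tendsto (fun z => f z / z) atTop (nhds lamP))
    (hfM : Tendsto (fun z => f (-z) / z) atTop (nhds (-lamM))) (ε : ℝ) (hε : 0 < ε) :
    ∃ A D : ℝ, ∀ x u : ℝ, 0 ≤ x → |f (x + u) - lamP * x| ≤ A + ε * x + D * |u| := by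
  obtain ⟨A, hA0, hA⟩ := kpz_lin f lamP hfloc hfP ε hε
  obtain ⟨B, hB0, hB⟩ := kpz_lin (fun z => f (-z)) (-lamM) hfloc' hfM 1 one_pos
  refine ⟨A + B, 1 + ε + |lamP| + |lamM|, fun x u hx => ?_⟩
  have hu := abs_nonneg u
  have e0 : 0 ≤ ε * x := by positivity
  have e1 : 0 ≤ ε * |u| := by positivity
  have e2 : 0 ≤ |lamP| * |u| := by positivity
  have e3 : 0 ≤ |lamM| * |u| := by positivity
  rcases le_total 0 (x + u) with h | h
  · have h1 := hA _ h
    have h2 : |f (x + u) - lamP * x| ≤ |f (x + u) - lamP * (x + u)| + |lamP| * |u| := by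
      rw [← abs_mul]
      have := abs_add_le (f (x + u) - lamP * (x + u)) (lamP * u)
      rwa [show f (x + u) - lamP * (x + u) + lamP * u = f (x + u) - lamP * x by ring] at this
    have h3 : ε * u ≤ ε * |u| := by gcongr; exact le_abs_self u
    nlinarith
  · have h1 := hB (-(x + u)) (by linarith)
    simp only [neg_neg] at h1
    have h4 : u ≤ 0 := by linarith
    have h5 : |u| = -u := abs_of_nonpos h4
    have h2 : |f (x + u) - lamP * x| ≤
        |f (x + u) - -lamM * -(x + u)| + |lamM| * |x + u| + |lamP| * |x| := by
      rw [← abs_mul, ← abs_mul]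
      have t1 := abs_add_le (f (x + u) - -lamM * -(x + u)) (lamM * (x + u))
      have t2 := abs_sub (f (x + u) - -lamM * -(x + u) + lamM * (x + u)) (lamP * x)
      have t3 : f (x + u) - -lamM * -(x + u) + lamM * (x + u) - lamP * x
        = f (x + u) - lamP * x := by ring
      rw [t3] at t2
      linarith
    have h6 : |x + u| ≤ |u| := by rw [abs_of_nonpos h, h5]; linarith
    have h7 : |x| ≤ |u| := by rw [abs_of_nonneg hx, h5]; linarith
    have h8 : |lamM| * |x + u| ≤ |lamM| * |u| := by gcongr
    have h9 : |lamP| * |x| ≤ |lamP| * |u| := by gcongr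
    nlinarith

lemma kpz_pow (t : ℝ) (ht : 0 ≤ t) : t ^ 4 ≤ 24 * Real.exp t := by
  have := Real.pow_div_factorial_le_exp t ht 4
  have h : ((Nat.factorial 4 : ℕ) : ℝ) = 24 := by norm_num [Nat.factorial]
  rw [h] at this
  linarith

lemma kpz_w (ε : ℝ) (hε : 0 < ε) : ∃ L : ℝ, ∀ x u : ℝ, 0 ≤ x →
    1 + x ^ 4 + (x + u) ^ 4 ≤ Real.exp (L + ε * x + |u|) := by
  refine ⟨Real.log (225 * (1 + 24 / ε ^ 4)), fun x u hx => ?_⟩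
  rw [Real.exp_add, Real.exp_add, Real.exp_log (by positivity)]
  have h1 : 1 + x ^ 4 ≤ (1 + 24 / ε ^ 4) * Real.exp (ε * x) := by
    have h := kpz_pow (ε * x) (by positivity)
    have h' : x ^ 4 ≤ 24 / ε ^ 4 * Real.exp (ε * x) := by
      rw [div_mul_eq_mul_div, le_div_iff₀ (by positivity)]
      linarith [mul_pow ε x 4]
    have : 1 ≤ Real.exp (ε * x) := Real.one_le_exp (by positivity)
    linarith
  have h2 : 1 + u ^ 4 ≤ 25 * Real.exp |u| := by
    have h := kpz_pow |u| (abs_nonneg u)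
    have h3 : |u| ^ 4 = u ^ 4 := by rw [show (4:ℕ) = 2 * 2 from rfl, pow_mul, sq_abs, pow_mul]
    have : 1 ≤ Real.exp |u| := Real.one_le_exp (abs_nonneg u)
    linarith
  have h3 : (x + u) ^ 4 ≤ 8 * x ^ 4 + 8 * u ^ 4 := by
    have a : (x + u) ^ 2 ≤ 2 * (x ^ 2 + u ^ 2) := by nlinarith [sq_nonneg (x - u)]
    have b : ((x + u) ^ 2) ^ 2 ≤ (2 * (x ^ 2 + u ^ 2)) ^ 2 := by gcongr
    nlinarith [sq_nonneg (x ^ 2 - u ^ 2)]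
  have h4 : 1 + x ^ 4 + (x + u) ^ 4 ≤ 9 * ((1 + x ^ 4) * (1 + u ^ 4)) := by
    have : 0 ≤ x ^ 4 * u ^ 4 := by positivity
    have : 0 ≤ u ^ 4 := by positivity
    nlinarith
  have h5 : (1 + x ^ 4) * (1 + u ^ 4) ≤
      ((1 + 24 / ε ^ 4) * Real.exp (ε * x)) * (25 * Real.exp |u|) := by gcongr
  nlinarith

lemma heatKer_pos' (τ : ℝ) (hτ : 0 < τ) (u : ℝ) : 0 < heatKer τ u := by
  unfold heatKer
  rw [if_pos hτ]
  have := Real.pi_pos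
  positivity

lemma heatKer_neg' (τ u : ℝ) : heatKer τ (-u) = heatKer τ u := by
  unfold heatKer
  simp

lemma heatKer_cont (τ : ℝ) (hτ : 0 < τ) : Continuous (heatKer τ) := by
  unfold heatKer
  simp only [if_pos hτ]
  fun_prop

lemma kpz_K_pos (τ : ℝ) (hτ : 0 < τ) (D : ℝ) :
    0 < ∫⁻ u : ℝ, ENNReal.ofReal (heatKer τ u * Real.exp (D * |u|)) := by
  have hc := heatKer_cont τ hτ
  rw [lintegral_pos_iff_support (by fun_prop)]
  have : Function.support (fun u : ℝ => ENNReal.ofReal (heatKer τ u * Real.exp (D * |u|)))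
      = Set.univ := by
    ext u
    simp only [Function.mem_support, Set.mem_univ, iff_true, ne_eq, ENNReal.ofReal_eq_zero, not_le]
    have := heatKer_pos' τ hτ u
    positivity
  rw [this]
  simp

lemma kpz_K_fin (τ : ℝ) (hτ : 0 < τ) (D : ℝ) :
    ∫⁻ u : ℝ, ENNReal.ofReal (heatKer τ u * Real.exp (D * |u|)) < ⊤ := by
  have hi : Integrable (fun u : ℝ => (Real.exp (τ * D ^ 2) / Real.sqrt (2 * Real.pi * τ)) *
      Real.exp (-(1 / (4 * τ)) * u ^ 2)) :=
    (integrable_exp_neg_mul_sq (by positivity)).const_mul _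
  refine lt_of_le_of_lt (lintegral_mono fun u => ENNReal.ofReal_le_ofReal ?_)
    hi.lintegral_lt_top
  unfold heatKer
  rw [if_pos hτ, div_mul_eq_mul_div, div_mul_eq_mul_div, ← Real.exp_add, ← Real.exp_add]
  refine div_le_div_of_nonneg_right (Real.exp_le_exp.2 ?_) (Real.sqrt_nonneg _)
  have h : τ * D ^ 2 + -(1 / (4 * τ)) * u ^ 2 - (-u ^ 2 / (2 * τ) + D * |u|)
      = (|u| - 2 * τ * D) ^ 2 / (4 * τ) := by
    rw [← sq_abs u]
    field_simp
    ring
  have : 0 ≤ (|u| - 2 * τ * D) ^ 2 / (4 * τ) := by positivity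
  linarith

/-- Half-line version: for `x ≥ 0`. -/
lemma kpz_half (τ : ℝ) (hτ : 0 < τ) (C : ℝ) (hC : 1 ≤ C)
    (w : ℝ → ℝ → ℝ)
    (hwl : ∀ x z : ℝ, C⁻¹ * (1 + x ^ 4 + z ^ 4)⁻¹ ≤ w x z)
    (hwu : ∀ x z : ℝ, w x z ≤ C * (1 + x ^ 4 + z ^ 4))
    (lamP lamM : ℝ) (f : ℝ → ℝ)
    (hfloc : ∀ K : Set ℝ, IsCompact K → ∃ M : ℝ, ∀ z ∈ K, |f z| ≤ M)
    (hfloc' : ∀ K : Set ℝ, IsCompact K → ∃ M : ℝ, ∀ z ∈ K, |f (-z)| ≤ M)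
    (hfP : Tendsto (fun z => f z / z) atTop (nhds lamP))
    (hfM : Tendsto (fun z => f (-z) / z) atTop (nhds (-lamM))) :
    (∀ x : ℝ, 0 ≤ x → 0 < gKPZ τ w f x ∧ gKPZ τ w f x < ⊤) ∧
    Tendsto (fun x => Real.log (gKPZ τ w f x).toReal / x) atTop (nhds lamP) := by
  have key : ∀ ε : ℝ, 0 < ε → ∃ L : ℝ, ∀ x : ℝ, 0 ≤ x →
      (0 < gKPZ τ w f x ∧ gKPZ τ w f x < ⊤) ∧
      |Real.log (gKPZ τ w f x).toReal - lamP * x| ≤ L + 2 * ε * x := by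
    intro ε hε
    obtain ⟨A, D, hf⟩ := kpz_f f lamP lamM hfloc hfloc' hfP hfM ε hε
    obtain ⟨L, hw⟩ := kpz_w ε hε
    have hC0 : 0 < C := by linarith
    have hClog : C = Real.exp (Real.log C) := (Real.exp_log hC0).symm
    set Kp := ∫⁻ u : ℝ, ENNReal.ofReal (heatKer τ u * Real.exp ((D + 1) * |u|)) with hKp
    set Km := ∫⁻ u : ℝ, ENNReal.ofReal (heatKer τ u * Real.exp (-(D + 1) * |u|)) with hKm
    have hKp0 : 0 < Kp := kpz_K_pos τ hτ _
    have hKp1 : Kp < ⊤ := kpz_K_fin τ hτ _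
    have hKm0 : 0 < Km := kpz_K_pos τ hτ _
    have hKm1 : Km < ⊤ := kpz_K_fin τ hτ _
    set S := Real.log C + L + A with hS
    refine ⟨S + |Real.log Kp.toReal| + |Real.log Km.toReal|, fun x hx => ?_⟩
    have hg : gKPZ τ w f x =
        ∫⁻ u : ℝ, ENNReal.ofReal (heatKer τ u * w x (x + u) * Real.exp (f (x + u))) := by
      unfold gKPZ
      rw [← lintegral_add_left_eq_self _ x]
      refine lintegral_congr fun u => ?_
      rw [show x - (x + u) = -u by ring, heatKer_neg']
    have hup : gKPZ τ w f x ≤ ENNReal.ofReal (Real.exp (S + lamP * x + 2 * ε * x)) * Kp := by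
      rw [hg, hKp, ← lintegral_const_mul' _ _ ENNReal.ofReal_ne_top]
      refine lintegral_mono fun u => ?_
      rw [← ENNReal.ofReal_mul (Real.exp_pos _).le]
      apply ENNReal.ofReal_le_ofReal
      have h1 : w x (x + u) ≤ Real.exp (Real.log C) * Real.exp (L + ε * x + |u|) := by
        rw [← hClog]
        exact (hwu _ _).trans (by gcongr; exact hw x u hx)
      have h2 := (abs_le.1 (hf x u hx)).2
      have h0 := (heatKer_pos' τ hτ u).le
      calc heatKer τ u * w x (x + u) * Real.exp (f (x + u))
          ≤ heatKer τ u * (Real.exp (Real.log C) * Real.exp (L + ε * x + |u|)) *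
            Real.exp (lamP * x + A + ε * x + D * |u|) := by
              gcongr
              linarith
        _ = heatKer τ u * Real.exp (Real.log C + (L + ε * x + |u|) +
              (lamP * x + A + ε * x + D * |u|)) := by
              rw [Real.exp_add (Real.log C + _), Real.exp_add (Real.log C)]; ring
        _ = heatKer τ u * Real.exp ((S + lamP * x + 2 * ε * x) + (D + 1) * |u|) := by
              congr 2; rw [hS]; ring
        _ = _ := by rw [Real.exp_add]; ring
    have hlo : ENNReal.ofReal (Real.exp (-S + lamP * x - 2 * ε * x)) * Km ≤ gKPZ τ w f x := by
      rw [hg, hKm, ← lintegral_const_mul' _ _ ENNReal.ofReal_ne_top]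
      refine lintegral_mono fun u => ?_
      rw [← ENNReal.ofReal_mul (Real.exp_pos _).le]
      apply ENNReal.ofReal_le_ofReal
      have h1 : Real.exp (-Real.log C) * Real.exp (-(L + ε * x + |u|)) ≤ w x (x + u) := by
        rw [Real.exp_neg, Real.exp_neg, ← hClog]
        refine le_trans ?_ (hwl _ _)
        have := hw x u hx
        gcongr
      have h2 := (abs_le.1 (hf x u hx)).1
      have h0 := (heatKer_pos' τ hτ u).le
      calc Real.exp (-S + lamP * x - 2 * ε * x) * (heatKer τ u * Real.exp (-(D + 1) * |u|))
          = heatKer τ u * Real.exp ((-S + lamP * x - 2 * ε * x) + (-(D + 1) * |u|)) := by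
              rw [Real.exp_add]; ring
        _ = heatKer τ u * Real.exp (-Real.log C + (-(L + ε * x + |u|)) +
              (lamP * x - (A + ε * x + D * |u|))) := by
              congr 2; rw [hS]; ring
        _ = heatKer τ u * (Real.exp (-Real.log C) * Real.exp (-(L + ε * x + |u|))) *
            Real.exp (lamP * x - (A + ε * x + D * |u|)) := by
              rw [Real.exp_add, Real.exp_add (-Real.log C)]; ring
        _ ≤ _ := by
              have h3 : 0 ≤ w x (x + u) := le_trans (by positivity) h1
              gcongr
              linarith
    have hgp : 0 < gKPZ τ w f x :=
      lt_of_lt_of_le (ENNReal.mul_pos (by simp [Real.exp_pos]) hKm0.ne') hlo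
    have hgf : gKPZ τ w f x < ⊤ :=
      lt_of_le_of_lt hup (ENNReal.mul_lt_top ENNReal.ofReal_lt_top hKp1)
    refine ⟨⟨hgp, hgf⟩, ?_⟩
    have rg : 0 < (gKPZ τ w f x).toReal := ENNReal.toReal_pos hgp.ne' hgf.ne
    have rp : 0 < Kp.toReal := ENNReal.toReal_pos hKp0.ne' hKp1.ne
    have rm : 0 < Km.toReal := ENNReal.toReal_pos hKm0.ne' hKm1.ne
    have u1 := ENNReal.toReal_mono (ENNReal.mul_lt_top ENNReal.ofReal_lt_top hKp1).ne hup
    have l1 := ENNReal.toReal_mono hgf.ne hlo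
    rw [ENNReal.toReal_mul, ENNReal.toReal_ofReal (Real.exp_pos _).le] at u1 l1
    have u2 := Real.log_le_log rg u1
    have l2 := Real.log_le_log (by positivity) l1
    rw [Real.log_mul (Real.exp_pos _).ne' rp.ne', Real.log_exp] at u2
    rw [Real.log_mul (Real.exp_pos _).ne' rm.ne', Real.log_exp] at l2
    have a1 := le_abs_self (Real.log Kp.toReal)
    have a2 := neg_abs_le (Real.log Km.toReal)
    have a3 := abs_nonneg (Real.log Kp.toReal)
    have a4 := abs_nonneg (Real.log Km.toReal)
    rw [abs_le]
    constructor <;> linarith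
  refine ⟨fun x hx => ?_, ?_⟩
  · obtain ⟨L, hL⟩ := key 1 one_pos
    exact (hL x hx).1
  · rw [Metric.tendsto_nhds]
    intro ε hε
    obtain ⟨L, hL⟩ := key (ε / 4) (by positivity)
    filter_upwards [eventually_gt_atTop 0, eventually_gt_atTop (2 * L / ε)] with x hx hx2
    have h1 := (hL x hx.le).2
    rw [div_lt_iff₀ hε] at hx2
    rw [Real.dist_eq, show Real.log (gKPZ τ w f x).toReal / x - lamP =
      (Real.log (gKPZ τ w f x).toReal - lamP * x) / x by field_simp, abs_div, abs_of_pos hx,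
      div_lt_iff₀ hx]
    linarith

lemma kpz_reflect (τ : ℝ) (w : ℝ → ℝ → ℝ) (f : ℝ → ℝ) (x : ℝ) :
    gKPZ τ (fun a b => w (-a) (-b)) (fun z => f (-z)) x = gKPZ τ w f (-x) := by
  unfold gKPZ
  rw [← lintegral_neg_eq_self]
  refine lintegral_congr fun z => ?_
  simp only [neg_neg]
  rw [← heatKer_neg', show -(x - -z) = -x - z by ring]


/-- Deterministic core of Proposition 2.5 (conservation of asymptotic slope for the
KPZ equation): if `f` is locally bounded Borel with asymptotic slopes `λ₊, λ₋` at
`±∞` and `w` satisfies two-sided quartic polynomial bounds, then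
`g(x) = ∫ ρ(τ,x−z) w(x,z) e^{f(z)} dz` is finite and positive, and
`log g(x) / x → λ₊` as `x → +∞` and `→ λ₋` as `x → −∞`. -/
theorem stmt15 (τ : ℝ) (hτ : 0 < τ) (C : ℝ) (hC : 1 ≤ C)
    (w : ℝ → ℝ → ℝ) (hwmeas : Measurable fun p : ℝ × ℝ => w p.1 p.2)
    (hwl : ∀ x z : ℝ, C⁻¹ * (1 + x ^ 4 + z ^ 4)⁻¹ ≤ w x z)
    (hwu : ∀ x z : ℝ, w x z ≤ C * (1 + x ^ 4 + z ^ 4))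
    (lamP lamM : ℝ) (f : ℝ → ℝ) (hfmeas : Measurable f)
    (hfloc : ∀ K : Set ℝ, IsCompact K → ∃ M : ℝ, ∀ z ∈ K, |f z| ≤ M)
    (hfP : Tendsto (fun z => f z / z) atTop (nhds lamP))
    (hfM : Tendsto (fun z => f z / z) atBot (nhds lamM)) :
    (∀ x : ℝ, 0 < gKPZ τ w f x ∧ gKPZ τ w f x < ⊤) ∧
    Tendsto (fun x => Real.log (gKPZ τ w f x).toReal / x) atTop (nhds lamP) ∧
    Tendsto (fun x => Real.log (gKPZ τ w f x).toReal / x) atBot (nhds lamM) := by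
  have hfloc' : ∀ K : Set ℝ, IsCompact K → ∃ M : ℝ, ∀ z ∈ K, |f (-z)| ≤ M := by
    intro K hK
    obtain ⟨M, hM⟩ := hfloc ((fun z => -z) '' K) (hK.image continuous_neg)
    exact ⟨M, fun z hz => hM _ ⟨z, hz, rfl⟩⟩
  have hfM' : Tendsto (fun z => f (-z) / z) atTop (nhds (-lamM)) := by
    have h := (hfM.comp tendsto_neg_atTop_atBot).neg
    refine h.congr fun z => ?_
    simp only [Function.comp]
    rw [div_neg, neg_neg]
  obtain ⟨p1, t1⟩ := kpz_half τ hτ C hC w hwl hwu lamP lamM f hfloc hfloc' hfP hfM'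
  obtain ⟨p2, t2⟩ := kpz_half τ hτ C hC (fun a b => w (-a) (-b))
    (fun x z => by simpa [Even.neg_pow (show Even 4 by decide)] using hwl (-x) (-z))
    (fun x z => by simpa [Even.neg_pow (show Even 4 by decide)] using hwu (-x) (-z))
    (-lamM) (-lamP) (fun z => f (-z)) hfloc' (by simpa using hfloc) hfM' (by simpa using hfP)
  simp only [kpz_reflect] at p2 t2
  refine ⟨fun x => ?_, t1, ?_⟩
  · rcases le_total 0 x with h | h
    · exact p1 x h
    · have := p2 (-x) (by linarith)
      rwa [neg_neg] at this
  · have h := (t2.comp tendsto_neg_atBot_atTop).neg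
    rw [neg_neg] at h
    refine h.congr fun x => ?_
    simp only [Function.comp]
    rw [neg_neg, div_neg, neg_neg]
end

section
/- Let (ζ_n)_{n ∈ ℕ} be a sequence of positive Borel measures on ℝ, each finite on compact sets, and let ζ be a positive Borel measure on ℝ, finite on compact sets, such that ζ_n → ζ vaguely, i.e. ∫_ℝ φ dζ_n → ∫_ℝ φ dζ for every continuous compactly supported φ : ℝ → ℝ. Suppose that for every b > 0, sup_n ∫_ℝ e^{−b y²} ζ_n(dy) < ∞ and the limit a_b := lim_{n→∞} ∫_ℝ e^{−b y²} ζ_n(dy) exists in ℝ. Then for every b > 0, a_b = ∫_ℝ e^{−b y²} ζ(dy). -/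
open MeasureTheory Filter

/-- Continuous cutoff equal to `1` on `[-k, k]` and `0` off `[-(k+1), k+1]`. -/
noncomputable def cutoffK (k : ℕ) (y : ℝ) : ℝ := max 0 (min 1 ((k : ℝ) + 1 - |y|))

theorem cutoffK_nonneg (k : ℕ) (y : ℝ) : 0 ≤ cutoffK k y := le_max_left _ _

theorem cutoffK_le_one (k : ℕ) (y : ℝ) : cutoffK k y ≤ 1 :=
  max_le zero_le_one (min_le_left _ _)

theorem cutoffK_eq_one {k : ℕ} {y : ℝ} (h : |y| ≤ k) : cutoffK k y = 1 := by
  unfold cutoffK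
  rw [min_eq_left (by linarith), max_eq_right zero_le_one]

theorem cutoffK_mono (y : ℝ) : Monotone (fun k => cutoffK k y) := by
  intro k l h
  have : (k : ℝ) ≤ l := by exact_mod_cast h
  unfold cutoffK
  dsimp only
  gcongr

theorem cutoffK_continuous (k : ℕ) : Continuous (cutoffK k) := by
  unfold cutoffK
  fun_prop

theorem cutoffK_support (k : ℕ) : HasCompactSupport (cutoffK k) := by
  refine HasCompactSupport.intro (isCompact_Icc (a := -((k : ℝ) + 1)) (b := (k : ℝ) + 1)) ?_
  intro y hy
  have h : (k : ℝ) + 1 < |y| := by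
    by_contra h
    exact hy (abs_le.mp (not_lt.mp h))
  unfold cutoffK
  exact max_eq_left ((min_le_right _ _).trans (by linarith))

theorem gauss_le_cutoffK (b : ℝ) (hb : 0 < b) (k : ℕ) (y : ℝ) :
    Real.exp (-b * y ^ 2) ≤ cutoffK k y * Real.exp (-b * y ^ 2)
      + Real.exp (-(b / 2) * (k : ℝ) ^ 2) * Real.exp (-(b / 2) * y ^ 2) := by
  rcases le_or_gt |y| k with h | h
  · rw [cutoffK_eq_one h, one_mul]
    have := Real.exp_pos (-(b / 2) * (k : ℝ) ^ 2)
    have := Real.exp_pos (-(b / 2) * y ^ 2)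
    nlinarith
  · have h1 : (k : ℝ) ^ 2 ≤ y ^ 2 := by
      rw [← sq_abs y]
      gcongr
    have h2 : Real.exp (-b * y ^ 2)
        ≤ Real.exp (-(b / 2) * (k : ℝ) ^ 2) * Real.exp (-(b / 2) * y ^ 2) := by
      rw [← Real.exp_add, Real.exp_le_exp]
      nlinarith
    have := mul_nonneg (cutoffK_nonneg k y) (Real.exp_pos (-b * y ^ 2)).le
    linarith

/-- The key step in Lemma D.1: if locally finite positive measures `ζ_n` converge
vaguely to `ζ`, all the Gaussian moments `∫ e^{−by²} dζ_n` are uniformly bounded in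
`n`, and for each `b > 0` they converge to `a b`, then
`a b = ∫ e^{−by²} dζ` for every `b > 0`. -/
theorem stmt16 (ζn : ℕ → Measure ℝ) (ζ : Measure ℝ)
    [∀ n, IsFiniteMeasureOnCompacts (ζn n)] [IsFiniteMeasureOnCompacts ζ]
    (hvague : ∀ φ : ℝ → ℝ, Continuous φ → HasCompactSupport φ →
      Tendsto (fun n => ∫ x, φ x ∂(ζn n)) atTop (nhds (∫ x, φ x ∂ζ)))
    (a : ℝ → ℝ)
    (hsup : ∀ b : ℝ, 0 < b → ∃ Cb : ℝ, ∀ n,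
      (∫⁻ y, ENNReal.ofReal (Real.exp (-b * y ^ 2)) ∂(ζn n)) ≤ ENNReal.ofReal Cb)
    (hlim : ∀ b : ℝ, 0 < b →
      Tendsto (fun n => (∫⁻ y, ENNReal.ofReal (Real.exp (-b * y ^ 2)) ∂(ζn n)).toReal)
        atTop (nhds (a b))) :
    ∀ b : ℝ, 0 < b →
      (∫⁻ y, ENNReal.ofReal (Real.exp (-b * y ^ 2)) ∂ζ) = ENNReal.ofReal (a b) := by
  intro b hb
  have hcont : ∀ c : ℝ, Continuous (fun y : ℝ => Real.exp (-c * y ^ 2)) := by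
    intro c
    fun_prop
  have hint : ∀ c : ℝ, 0 < c → ∀ n, Integrable (fun y : ℝ => Real.exp (-c * y ^ 2)) (ζn n) := by
    intro c hc n
    obtain ⟨C, hC⟩ := hsup c hc
    refine (lintegral_ofReal_ne_top_iff_integrable (hcont c).aestronglyMeasurable
      (Eventually.of_forall fun y => (Real.exp_pos _).le)).1 ?_
    exact ((hC n).trans_lt ENNReal.ofReal_lt_top).ne
  have htoReal : ∀ c : ℝ, ∀ n,
      (∫⁻ y, ENNReal.ofReal (Real.exp (-c * y ^ 2)) ∂(ζn n)).toReal
        = ∫ y, Real.exp (-c * y ^ 2) ∂(ζn n) := by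
    intro c n
    exact (integral_eq_lintegral_of_nonneg_ae
      (Eventually.of_forall fun y => (Real.exp_pos _).le) (hcont c).aestronglyMeasurable).symm
  obtain ⟨C, hC⟩ := hsup (b / 2) (by positivity)
  have hC' : ∀ n, ∫ y, Real.exp (-(b / 2) * y ^ 2) ∂(ζn n) ≤ max C 0 := by
    intro n
    rw [← htoReal]
    refine ENNReal.toReal_le_of_le_ofReal (le_max_right _ _) ((hC n).trans ?_)
    exact ENNReal.ofReal_le_ofReal (le_max_left _ _)
  have hlimb := hlim b hb
  simp only [htoReal] at hlimb
  have hφc : ∀ k, Continuous (fun y => cutoffK k y * Real.exp (-b * y ^ 2)) :=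
    fun k => (cutoffK_continuous k).mul (hcont b)
  have hφs : ∀ k, HasCompactSupport (fun y => cutoffK k y * Real.exp (-b * y ^ 2)) :=
    fun k => (cutoffK_support k).mul_right
  have hφ0 : ∀ k y, 0 ≤ cutoffK k y * Real.exp (-b * y ^ 2) :=
    fun k y => mul_nonneg (cutoffK_nonneg k y) (Real.exp_pos _).le
  have hv := fun k => hvague _ (hφc k) (hφs k)
  have hupper : ∀ k, ∫ y, cutoffK k y * Real.exp (-b * y ^ 2) ∂ζ ≤ a b := by
    intro k
    refine le_of_tendsto_of_tendsto' (hv k) hlimb fun n => ?_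
    refine integral_mono ((hφc k).integrable_of_hasCompactSupport (hφs k)) (hint b hb n) ?_
    intro y
    exact mul_le_of_le_one_left (Real.exp_pos _).le (cutoffK_le_one k y)
  have hlower : ∀ k : ℕ, a b ≤ ∫ y, cutoffK k y * Real.exp (-b * y ^ 2) ∂ζ
      + Real.exp (-(b / 2) * (k : ℝ) ^ 2) * max C 0 := by
    intro k
    refine le_of_tendsto_of_tendsto' hlimb ((hv k).add_const _) fun n => ?_
    have i1 := (hφc k).integrable_of_hasCompactSupport (μ := ζn n) (hφs k)
    have i2 := (hint (b / 2) (by positivity) n).const_mul (Real.exp (-(b / 2) * (k : ℝ) ^ 2))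
    have h1 := integral_mono (hint b hb n) (i1.add i2) (fun y => gauss_le_cutoffK b hb k y)
    rw [integral_add' i1 i2, integral_const_mul] at h1
    refine h1.trans ?_
    gcongr
    exact hC' n
  have herr : Tendsto (fun k : ℕ => Real.exp (-(b / 2) * (k : ℝ) ^ 2) * max C 0) atTop
      (nhds 0) := by
    have h1 : Tendsto (fun k : ℕ => (b / 2) * (k : ℝ) ^ 2) atTop atTop :=
      ((tendsto_pow_atTop two_ne_zero).comp tendsto_natCast_atTop_atTop).const_mul_atTop
        (by positivity)
    have h2 := (Real.tendsto_exp_neg_atTop_nhds_zero.comp h1).mul_const (max C 0)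
    simpa [Function.comp_def] using h2
  have hI : Tendsto (fun k => ∫ y, cutoffK k y * Real.exp (-b * y ^ 2) ∂ζ) atTop
      (nhds (a b)) := by
    have h0 : Tendsto (fun k : ℕ => a b - Real.exp (-(b / 2) * (k : ℝ) ^ 2) * max C 0) atTop
        (nhds (a b)) := by
      simpa using herr.const_sub (a b)
    exact tendsto_of_tendsto_of_tendsto_of_le_of_le h0 tendsto_const_nhds
      (fun k => sub_le_iff_le_add.2 (hlower k)) hupper
  have hI' := ENNReal.tendsto_ofReal hI
  have hmono : Tendsto (fun k => ∫⁻ y, ENNReal.ofReal (cutoffK k y * Real.exp (-b * y ^ 2)) ∂ζ)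
      atTop (nhds (∫⁻ y, ENNReal.ofReal (Real.exp (-b * y ^ 2)) ∂ζ)) := by
    refine lintegral_tendsto_of_tendsto_of_monotone
      (fun k => (hφc k).measurable.ennreal_ofReal.aemeasurable) ?_ ?_
    · refine Eventually.of_forall fun y k l h => ?_
      exact ENNReal.ofReal_le_ofReal
        (mul_le_mul_of_nonneg_right (cutoffK_mono y h) (Real.exp_pos _).le)
    · refine Eventually.of_forall fun y => ?_
      refine tendsto_const_nhds.congr' ?_
      obtain ⟨N, hN⟩ := exists_nat_ge |y|
      filter_upwards [eventually_ge_atTop N] with k hk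
      rw [cutoffK_eq_one (hN.trans (by exact_mod_cast hk)), one_mul]
  refine tendsto_nhds_unique hmono (hI'.congr fun k => ?_)
  exact ofReal_integral_eq_lintegral_ofReal
    ((hφc k).integrable_of_hasCompactSupport (hφs k)) (Eventually.of_forall (hφ0 k))
end

section
/- For t > 0 and α ≥ 0, define I(α) = (t/(2√π)) · ∫₀^∞ e^{−α s} / ( √s · (1 + s·t) ) ds. Then I(0) = √(πt)/2, and for every α ≥ 0, I(α) ≥ √(πt)/2 − √α. -/
open MeasureTheory

/-- `I(α) = (t/(2√π)) ∫₀^∞ e^{−αs} / (√s (1 + st)) ds`. -/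
noncomputable def Ifun (t α : ℝ) : ℝ :=
  t / (2 * Real.sqrt Real.pi) *
    ∫ s in Set.Ioi (0:ℝ), Real.exp (-α * s) / (Real.sqrt s * (1 + s * t))

/-- Substitution `s = u²`. -/
lemma Ifun_eq (t α : ℝ) : Ifun t α = t / Real.sqrt Real.pi *
    ∫ u in Set.Ioi (0:ℝ), Real.exp (-α * u ^ 2) * (1 + (Real.sqrt t * u) ^ 2)⁻¹ ∨ t ≤ 0 := by
  rcases le_or_gt t 0 with h | ht
  · exact Or.inr h
  left
  unfold Ifun
  rw [← integral_comp_rpow_Ioi_of_pos (p := 2) two_pos]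
  have : ∫ x in Set.Ioi (0:ℝ), ((2:ℝ) * x ^ ((2:ℝ) - 1)) •
      (Real.exp (-α * x ^ (2:ℝ)) / (Real.sqrt (x ^ (2:ℝ)) * (1 + x ^ (2:ℝ) * t)))
      = ∫ u in Set.Ioi (0:ℝ), 2 * (Real.exp (-α * u ^ 2) * (1 + (Real.sqrt t * u) ^ 2)⁻¹) := by
    apply setIntegral_congr_fun measurableSet_Ioi
    intro x hx
    have hx : 0 < x := hx
    have h1 : (2:ℝ) - 1 = 1 := by norm_num
    have h2 : 0 < 1 + x ^ 2 * t := by positivity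
    simp only [h1, Real.rpow_one, Real.rpow_two, Real.sqrt_sq hx.le, smul_eq_mul, mul_pow,
      Real.sq_sqrt ht.le]
    rw [mul_comm t]
    field_simp
  rw [this, integral_const_mul]
  have : 0 < Real.sqrt Real.pi := Real.sqrt_pos.2 Real.pi_pos
  rw [← mul_assoc]
  congr 1
  field_simp

lemma base_integrable (t : ℝ) (ht : 0 < t) :
    Integrable (fun u : ℝ => (1 + (Real.sqrt t * u) ^ 2)⁻¹) :=
  integrable_inv_one_add_sq.comp_mul_left' (Real.sqrt_pos.2 ht).ne'

lemma exp_aux (α : ℝ) (hα : 0 < α) (u : ℝ) :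
    0 ≤ 1 - Real.exp (-α * u ^ 2) ∧ 1 - Real.exp (-α * u ^ 2) ≤ 1 ∧
    1 - Real.exp (-α * u ^ 2) ≤ α * u ^ 2 := by
  refine ⟨?_, ?_, ?_⟩
  · have : Real.exp (-α * u ^ 2) ≤ 1 := Real.exp_le_one_iff.2 (by nlinarith [sq_nonneg u])
    linarith
  · linarith [Real.exp_pos (-α * u ^ 2)]
  · linarith [Real.add_one_le_exp (-α * u ^ 2)]

lemma h_integrable (α : ℝ) (hα : 0 < α) :
    IntegrableOn (fun u : ℝ => (1 - Real.exp (-α * u ^ 2)) / u ^ 2) (Set.Ioi 0) := by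
  have h := (integrable_inv_one_add_sq.const_mul (1 + α)).integrableOn (s := Set.Ioi (0:ℝ))
  refine Integrable.mono' h (Measurable.aestronglyMeasurable (by fun_prop)) ?_
  filter_upwards [ae_restrict_mem measurableSet_Ioi] with u hu
  have hu : 0 < u := hu
  obtain ⟨h0, h1, h2⟩ := exp_aux α hα u
  rw [Real.norm_of_nonneg (by positivity), ← div_eq_mul_inv,
    div_le_div_iff₀ (by positivity) (by positivity)]
  nlinarith [sq_nonneg u]

lemma h_integral (α : ℝ) (hα : 0 < α) :
    ∫ u in Set.Ioi (0:ℝ), (1 - Real.exp (-α * u ^ 2)) / u ^ 2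
      = Real.sqrt Real.pi * Real.sqrt α := by
  have hg : IntegrableOn (fun u : ℝ => 2 * α * Real.exp (-α * u ^ 2)) (Set.Ioi 0) :=
    ((integrable_exp_neg_mul_sq hα).const_mul _).integrableOn
  have key : ∫ u in Set.Ioi (0:ℝ), ((1 - Real.exp (-α * u ^ 2)) / u ^ 2
      - 2 * α * Real.exp (-α * u ^ 2)) = 0 - (fun u : ℝ => -((1 - Real.exp (-α * u ^ 2)) / u)) 0 := by
    refine integral_Ioi_of_hasDerivAt_of_tendsto
      (f := fun u : ℝ => -((1 - Real.exp (-α * u ^ 2)) / u)) ?_ ?_ ?_ ?_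
    · apply ContinuousAt.continuousWithinAt
      unfold ContinuousAt
      have hz : (fun u : ℝ => -((1 - Real.exp (-α * u ^ 2)) / u)) 0 = 0 := by simp
      rw [hz]
      have h3 : Filter.Tendsto (fun u : ℝ => α * |u|) (nhds 0) (nhds 0) := by
        have : Continuous (fun u : ℝ => α * |u|) := by fun_prop
        simpa using this.tendsto 0
      refine squeeze_zero_norm (fun u => ?_) h3
      obtain ⟨h0, h1, h2⟩ := exp_aux α hα u
      rw [norm_neg, norm_div, Real.norm_of_nonneg h0, Real.norm_eq_abs]
      rcases eq_or_ne u 0 with rfl | hu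
      · simp
      · rw [div_le_iff₀ (abs_pos.2 hu), mul_assoc, abs_mul_abs_self]
        linarith [sq u, h2, mul_comm u u, congrArg (α * ·) (sq u)]
    · intro u hu
      have hu : 0 < u := hu
      have h1 : HasDerivAt (fun u : ℝ => -α * u ^ 2) (-α * (2 * u)) u := by
        simpa using (hasDerivAt_pow 2 u).const_mul (-α)
      have h2 := (((h1.exp.const_sub 1).div (hasDerivAt_id u) hu.ne')).neg
      refine HasDerivAt.congr_deriv (f := fun u : ℝ => -((1 - Real.exp (-α * u ^ 2)) / u)) h2 ?_
      simp only [id]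
      field_simp
      ring
    · exact (h_integrable α hα).sub hg
    · have h3 : Filter.Tendsto (fun u : ℝ => u⁻¹) Filter.atTop (nhds 0) := tendsto_inv_atTop_zero
      refine squeeze_zero_norm' ?_ h3
      filter_upwards [Filter.eventually_gt_atTop 0] with u hu
      obtain ⟨h0, h1, h2⟩ := exp_aux α hα u
      rw [norm_neg, norm_div, Real.norm_of_nonneg h0, Real.norm_of_nonneg hu.le, ← one_div]
      gcongr
  rw [integral_sub (h_integrable α hα) hg, integral_const_mul, integral_gaussian_Ioi] at key
  have hs : Real.sqrt (Real.pi / α) = Real.sqrt Real.pi / Real.sqrt α :=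
    Real.sqrt_div Real.pi_pos.le α
  have hp : 0 < Real.sqrt α := Real.sqrt_pos.2 hα
  have e : 2 * α * (Real.sqrt (Real.pi / α) / 2) = Real.sqrt Real.pi * Real.sqrt α := by
    rw [hs]
    field_simp
    rw [Real.sq_sqrt hα.le]
  rw [e] at key
  have hz : (fun u : ℝ => -((1 - Real.exp (-α * u ^ 2)) / u)) 0 = 0 := by simp
  rw [hz] at key
  linarith

lemma Ifun_zero (t : ℝ) (ht : 0 < t) : Ifun t 0 = Real.sqrt (Real.pi * t) / 2 := by
  rw [(Ifun_eq t 0).resolve_right (not_le.2 ht)]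
  have hs : 0 < Real.sqrt t := Real.sqrt_pos.2 ht
  have hp : 0 < Real.sqrt Real.pi := Real.sqrt_pos.2 Real.pi_pos
  have := integral_comp_mul_left_Ioi (fun x : ℝ => (1 + x ^ 2)⁻¹) 0 hs
  simp only [neg_zero, zero_mul, Real.exp_zero, one_mul]
  rw [this, mul_zero, integral_Ioi_inv_one_add_sq, Real.arctan_zero, sub_zero,
    Real.sqrt_mul Real.pi_pos.le, smul_eq_mul]
  field_simp
  rw [Real.sq_sqrt ht.le, Real.sq_sqrt Real.pi_pos.le]
  try ring

/-- The Laplace-transform estimate from the proof of Lemma C.5 (lem:xybd):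
`I(0) = √(πt)/2`, and `I(α) ≥ √(πt)/2 − √α` for all `α ≥ 0`. -/
theorem stmt17 (t : ℝ) (ht : 0 < t) :
    Ifun t 0 = Real.sqrt (Real.pi * t) / 2 ∧
    ∀ α : ℝ, 0 ≤ α → Real.sqrt (Real.pi * t) / 2 - Real.sqrt α ≤ Ifun t α := by
  refine ⟨Ifun_zero t ht, fun α hα0 => ?_⟩
  rcases hα0.eq_or_lt with rfl | hα
  · rw [Ifun_zero t ht]; simp
  have hp : 0 < Real.sqrt Real.pi := Real.sqrt_pos.2 Real.pi_pos
  rw [← Ifun_zero t ht, (Ifun_eq t 0).resolve_right (not_le.2 ht),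
    (Ifun_eq t α).resolve_right (not_le.2 ht)]
  simp only [neg_zero, zero_mul, Real.exp_zero, one_mul]
  have hb := (base_integrable t ht).integrableOn (s := Set.Ioi (0:ℝ))
  have he : IntegrableOn (fun u : ℝ => Real.exp (-α * u ^ 2) * (1 + (Real.sqrt t * u) ^ 2)⁻¹)
      (Set.Ioi 0) := by
    refine Integrable.mono' hb (Measurable.aestronglyMeasurable (by fun_prop)) ?_
    filter_upwards with u
    obtain ⟨h0, h1, h2⟩ := exp_aux α hα u
    rw [Real.norm_of_nonneg (by positivity)]
    exact mul_le_of_le_one_left (by positivity) (by linarith)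
  have hle : ∫ u in Set.Ioi (0:ℝ), ((1 + (Real.sqrt t * u) ^ 2)⁻¹
      - Real.exp (-α * u ^ 2) * (1 + (Real.sqrt t * u) ^ 2)⁻¹) ≤
      ∫ u in Set.Ioi (0:ℝ), t⁻¹ * ((1 - Real.exp (-α * u ^ 2)) / u ^ 2) := by
    apply setIntegral_mono_on (hb.sub he) ((h_integrable α hα).const_mul _) measurableSet_Ioi
    intro u hu
    have hu : 0 < u := hu
    obtain ⟨h0, h1, h2⟩ := exp_aux α hα u
    have e1 : (1 + (Real.sqrt t * u) ^ 2)⁻¹ ≤ (t * u ^ 2)⁻¹ := by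
      rw [mul_pow, Real.sq_sqrt ht.le]
      apply inv_anti₀ (by positivity)
      linarith
    calc _ = (1 - Real.exp (-α * u ^ 2)) * (1 + (Real.sqrt t * u) ^ 2)⁻¹ := by
          simp only [Pi.sub_apply]
          ring
      _ ≤ (1 - Real.exp (-α * u ^ 2)) * (t * u ^ 2)⁻¹ := mul_le_mul_of_nonneg_left e1 h0
      _ = _ := by field_simp
  rw [integral_sub hb he, integral_const_mul, h_integral α hα] at hle
  have h4 := mul_le_mul_of_nonneg_left hle (by positivity : 0 ≤ t / Real.sqrt Real.pi)
  have h5 : t / Real.sqrt Real.pi * (t⁻¹ * (Real.sqrt Real.pi * Real.sqrt α)) = Real.sqrt α := by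
    field_simp
  rw [h5, mul_sub] at h4
  linarith
end

section
/- For all t > 0 and all α ≥ 0: ∫₀ᵗ √( t / ( r·(t−r) ) ) · exp( −α·r / ( t·(t−r) ) ) dr = t · ∫₀^∞ e^{−α s} / ( √s · (1 + s·t) ) ds. -/
open MeasureTheory

/-- The change-of-variables identity (via `s = r/(t(t−r))`) from the proof of
Lemma C.5 (lem:xybd): for `t > 0` and `α ≥ 0`,
`∫₀ᵗ √(t/(r(t−r))) exp(−αr/(t(t−r))) dr = t ∫₀^∞ e^{−αs}/(√s (1+st)) ds`. -/
theorem stmt18 (t α : ℝ) (ht : 0 < t) (hα : 0 ≤ α) :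
    (∫ r in (0:ℝ)..t,
        Real.sqrt (t / (r * (t - r))) * Real.exp (-α * r / (t * (t - r)))) =
      t * ∫ s in Set.Ioi (0:ℝ), Real.exp (-α * s) / (Real.sqrt s * (1 + s * t)) := by
  have hpos : ∀ s ∈ Set.Ioi (0:ℝ), 0 < 1 + s * t := fun s hs => by
    have : 0 < s := hs
    positivity
  have hder : ∀ s ∈ Set.Ioi (0:ℝ), HasDerivWithinAt (fun s : ℝ => s * t ^ 2 / (1 + s * t))
      (t ^ 2 / (1 + s * t) ^ 2) (Set.Ioi 0) s := by
    intro s hs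
    have h := hpos s hs
    have h1 : HasDerivAt (fun s : ℝ => s * t ^ 2) (1 * t ^ 2) s :=
      (hasDerivAt_id s).mul_const _
    have h2 : HasDerivAt (fun s : ℝ => 1 + s * t) (1 * t) s :=
      ((hasDerivAt_id s).mul_const t).const_add 1
    have h3 := (h1.div h2 h.ne').hasDerivWithinAt (s := Set.Ioi 0)
    have h4 : (1 * t ^ 2 * (1 + s * t) - s * t ^ 2 * (1 * t)) / (1 + s * t) ^ 2
        = t ^ 2 / (1 + s * t) ^ 2 := by
      congr 1
      ring
    rw [h4] at h3
    exact h3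
  have hinj : Set.InjOn (fun s : ℝ => s * t ^ 2 / (1 + s * t)) (Set.Ioi 0) := by
    intro a ha b hb hab
    have h1 := hpos a ha
    have h2 := hpos b hb
    simp only at hab
    rw [div_eq_div_iff h1.ne' h2.ne'] at hab
    have h3 : t ^ 2 * (a - b) = 0 := by linear_combination hab
    have h4 : t ^ 2 ≠ 0 := by positivity
    have := (mul_eq_zero.mp h3).resolve_left h4
    linarith
  have himg : (fun s : ℝ => s * t ^ 2 / (1 + s * t)) '' (Set.Ioi 0) = Set.Ioo 0 t := by
    ext r
    constructor
    · rintro ⟨s, hs, rfl⟩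
      have h := hpos s hs
      have hs' : 0 < s := hs
      refine ⟨by positivity, ?_⟩
      simp only
      rw [div_lt_iff₀ h]
      nlinarith
    · rintro ⟨h0, h1⟩
      have h2 : 0 < t - r := by linarith
      refine ⟨r / (t * (t - r)), ?_, ?_⟩
      · show 0 < r / (t * (t - r))
        positivity
      · have h3 : 1 + r / (t * (t - r)) * t = t / (t - r) := by
          field_simp
          ring
        simp only
        rw [h3]
        field_simp
  rw [intervalIntegral.integral_of_le ht.le, integral_Ioc_eq_integral_Ioo, ← himg,
    integral_image_eq_integral_abs_deriv_smul measurableSet_Ioi hder hinj,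
    ← integral_const_mul]
  refine setIntegral_congr_fun measurableSet_Ioi ?_
  intro s hs
  have h := hpos s hs
  have hs' : 0 < s := hs
  have e1 : t - s * t ^ 2 / (1 + s * t) = t / (1 + s * t) := by
    field_simp
    ring
  have e2 : t / (s * t ^ 2 / (1 + s * t) * (t / (1 + s * t)))
      = ((1 + s * t) / t) ^ 2 / s := by
    field_simp
  have e3 : -α * (s * t ^ 2 / (1 + s * t)) / (t * (t / (1 + s * t))) = -α * s := by
    field_simp
  have e4 : |t ^ 2 / (1 + s * t) ^ 2| = t ^ 2 / (1 + s * t) ^ 2 := abs_of_pos (by positivity)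
  have hsq : 0 < Real.sqrt s := Real.sqrt_pos.mpr hs'
  simp only [smul_eq_mul]
  rw [e1, e2, e3, e4, Real.sqrt_div (by positivity), Real.sqrt_sq (by positivity)]
  field_simp
end
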